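/- Let λ be a rectangular partition of N and X = SYT(λ), with the cyclic group C = ℤ/Nℤ acting on X by jeu de taquin promotion. Then (X, C, X(q)) exhibits the cyclic sieving phenomenon, where X(q) = [N]_q! / Π_{(i,j) ∈ λ} [h_{ij}]_q is the q-analogue of the hook length formula. -/

import Mathlib

/-! ### Tableau machinery: fillings as functions `ℕ × ℕ → ℕ` (entry `0` = empty/absent cell) -/

/-- One jeu de taquin slide: starting from an empty box at position `c`, repeatedly swap the
empty box with the smaller of the entries directly to its right and directly below it
(`0` denotes an empty/absent cell), until neither exists.  Returns the resulting filling
together with the final position of the empty box; `fuel` bounds the number of steps. -/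
def jdtSlide : ℕ → ((ℕ × ℕ) → ℕ) → (ℕ × ℕ) → (((ℕ × ℕ) → ℕ) × (ℕ × ℕ))
  | 0, f, c => (f, c)
  | fuel+1, f, c =>
    let a := c.1
    let b := c.2
    let r := f (a, b+1)
    let d := f (a+1, b)
    if r = 0 ∧ d = 0 then (f, c)
    else if d = 0 ∨ (r ≠ 0 ∧ r < d) then
      jdtSlide fuel (Function.update (Function.update f (a, b+1) 0) (a, b) r) (a, b+1)
    else
      jdtSlide fuel (Function.update (Function.update f (a+1, b) 0) (a, b) d) (a+1, b)

/-- Jeu de taquin promotion of a standard filling with `N` boxes: delete the entry `1`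
(in the upper left corner `(0,0)`), decrease every other entry by `1`, slide the empty box
by jeu de taquin, and fill the final empty box with `N`. -/
def promote (N : ℕ) (f : (ℕ × ℕ) → ℕ) : (ℕ × ℕ) → ℕ :=
  let s := jdtSlide N (fun c => f c - 1) (0, 0)
  Function.update s.1 s.2 N

/-- The cells of the (straight-shape) Young diagram of a partition `lam`:
row `a` consists of the cells `(a, b)` with `b < lam a`. -/
def strCell (lam : List ℕ) (c : ℕ × ℕ) : Prop := c.2 < lam.getD c.1 0

/-- The cells of the shifted Young diagram of a strict partition `lam`:
row `a` consists of the cells `(a, b)` with `a ≤ b < a + lam a`. -/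
def shiftCell (lam : List ℕ) (c : ℕ × ℕ) : Prop :=
  c.1 ≤ c.2 ∧ c.2 < c.1 + lam.getD c.1 0

/-- `IsStdFilling cells N f` : `f` is a standard tableau on the cell set `cells` with
entries `1, …, N`: it vanishes off `cells`, restricts to a bijection `cells → {1, …, N}`,
and is strictly increasing along rows and columns. -/
def IsStdFilling (cells : ℕ × ℕ → Prop) (N : ℕ) (f : (ℕ × ℕ) → ℕ) : Prop :=
  (∀ c, ¬ cells c → f c = 0) ∧
  (∀ c, cells c → 1 ≤ f c ∧ f c ≤ N) ∧
  (∀ c c', cells c → cells c' → f c = f c' → c = c') ∧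
  (∀ v, 1 ≤ v → v ≤ N → ∃ c, cells c ∧ f c = v) ∧
  (∀ a b, cells (a, b) → cells (a, b+1) → f (a, b) < f (a, b+1)) ∧
  (∀ a b, cells (a, b) → cells (a+1, b) → f (a, b) < f (a+1, b))

/-- The rectangular partition with `b` rows and `n` columns. -/
def rectShape (b n : ℕ) : List ℕ := List.replicate b n

/-- The square partition with `n` rows and `n` columns. -/
def sqShape (n : ℕ) : List ℕ := List.replicate n n

/-- The doubled staircase strict partition `(2n-1, 2n-3, …, 1)`. -/
def dblStair (n : ℕ) : List ℕ := (List.range n).map (fun i => 2*n - 1 - 2*i)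

/-- The index of the row containing the entry `v` of a filling
(rows numbered `0, 1, 2, …` from the top). -/
noncomputable def rowOf (f : (ℕ × ℕ) → ℕ) (v : ℕ) : ℕ := sInf {a | ∃ b, f (a, b) = v}

/-! ### `q`-analogues, as polynomials with integer coefficients -/

open Polynomial in
/-- The `q`-integer `[m]_q = 1 + q + ⋯ + q^(m-1)`, as a polynomial in `ℤ[q]`. -/
noncomputable def qInt (m : ℕ) : Polynomial ℤ := ∑ k ∈ Finset.range m, Polynomial.X ^ k

/-- The `q`-factorial `[N]_q! = [N]_q [N-1]_q ⋯ [1]_q`. -/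
noncomputable def qFact (N : ℕ) : Polynomial ℤ := ∏ m ∈ Finset.range N, qInt (m + 1)

open Polynomial in
/-- The `q`-analogue of the hook length formula for the rectangular shape with `b` rows and
`n` columns: `[bn]_q! / ∏_((i,j) ∈ λ) [h_(ij)]_q`, the hook length of the cell `(i, j)`
(`0`-based) being `b + n - 1 - i - j`.  (The division is exact; it is expressed by
`Polynomial.divByMonic`, the divisor being a monic polynomial.) -/
noncomputable def qHookRect (b n : ℕ) : Polynomial ℤ :=
  qFact (b * n) /ₘ ∏ i ∈ Finset.range b, ∏ j ∈ Finset.range n, qInt (b + n - 1 - i - j)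




/-! ### Braid / Coxeter combinatorics -/

section FullTwist
variable {M : Type*} [Monoid M]

/-- ascending product `T a * T (a+1) * ... * T (a+len-1)` -/
def ascP (T : ℕ → M) : ℕ → ℕ → M
  | _, 0 => 1
  | a, len+1 => T a * ascP T (a+1) len

/-- descending product `T i * T (i-1) * ...` with `j` factors -/
def descP (T : ℕ → M) : ℕ → ℕ → M
  | _, 0 => 1
  | i, j+1 => T i * descP T (i-1) j

lemma ascP_succ_right (T : ℕ → M) (a len : ℕ) :
    ascP T a (len+1) = ascP T a len * T (a+len) := by
  induction len generalizing a with
  | zero => simp [ascP]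
  | succ l ih =>
    rw [ascP, ih (a+1), ascP, mul_assoc]
    congr 3; omega

lemma ascP_comm (T : ℕ → M) (x : M) (a len : ℕ)
    (h : ∀ i, a ≤ i → i < a + len → x * T i = T i * x) : x * ascP T a len = ascP T a len * x := by
  induction len generalizing a with
  | zero => simp [ascP]
  | succ l ih =>
    rw [ascP, ← mul_assoc, h a le_rfl (by omega), mul_assoc, ih (a+1) (fun i h1 h2 => h i (by omega) (by omega)),
      mul_assoc]

lemma ascP_shift (T : ℕ → M) (n : ℕ)
    (hb : ∀ i, i + 1 < n → T i * T (i+1) * T i = T (i+1) * T i * T (i+1))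
    (hc : ∀ i j, i + 2 ≤ j → j < n → T i * T j = T j * T i) (a len i : ℕ) (h1 : a < i)
    (h2 : i < a + len) (h3 : a + len ≤ n) :
    T i * ascP T a len = ascP T a len * T (i-1) := by
  induction len generalizing a with
  | zero => omega
  | succ l ih =>
    by_cases h : i = a + 1
    · subst h
      cases l with
      | zero => omega
      | succ l =>
        simp only [ascP, Nat.add_sub_cancel]
        have := ascP_comm T (T a) (a+1+1) l (fun i h1 h2 => hc a i (by omega) (by omega))
        rw [← mul_assoc, ← mul_assoc, ← hb a (by omega), mul_assoc, this]
        simp only [mul_assoc]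
    · rw [ascP, ← mul_assoc, ← hc a i (by omega) (by omega), mul_assoc, ih (a+1) (by omega) (by omega) (by omega),
        mul_assoc]

lemma fullTwist (T L : ℕ → M) (n : ℕ)
    (hb : ∀ i, i + 1 < n → T i * T (i+1) * T i = T (i+1) * T i * T (i+1))
    (hc : ∀ i j, i + 2 ≤ j → j < n → T i * T j = T j * T i)
    (hL0 : L 0 = 1) (hL : ∀ i, i < n → T i * L i * T i = L (i+1)) (m : ℕ) (hm : m ≤ n) :
    (ascP T 0 m)^(m+1) = ascP L 0 (m+1) := by
  have hL' : ∀ m, m ≤ n → L m = descP T (m-1) m * ascP T 0 m := by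
    intro m
    induction m with
    | zero => intro _; simp [descP, ascP, hL0]
    | succ m ih =>
      intro hm
      rw [← hL m (by omega), ih (by omega), ascP_succ_right]
      simp [descP, mul_assoc]
  have hU : ∀ m j i, m ≤ n → j ≤ i → i < m → descP T i j * ascP T 0 m = ascP T 0 m * descP T (i-1) j := by
    intro m j
    induction j with
    | zero => intros; simp [descP]
    | succ j ih =>
      intro i hm hj hi
      rw [descP, mul_assoc, ih (i-1) hm (by omega) (by omega), ← mul_assoc,
        ascP_shift T n hb hc 0 m i (by omega) (by omega) (by omega), mul_assoc]
      rfl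
  have hpow : ∀ m j, m + 1 ≤ n → j ≤ m + 1 →
      (ascP T 0 (m+1))^j = (ascP T 0 m)^j * descP T m j := by
    intro m j hm
    induction j with
    | zero => intros; simp [descP]
    | succ j ih =>
      intro hj
      rw [pow_succ, ih (by omega), mul_assoc, hU (m+1) j m hm (by omega) (by omega), ascP_succ_right,
        pow_succ]
      simp [mul_assoc, descP]
  induction m with
  | zero => simp [ascP, hL0]
  | succ m ih =>
    rw [pow_succ, hpow m (m+1) hm le_rfl, ih (by omega), ascP_succ_right L 0 (m+1), mul_assoc]
    congr 1
    rw [zero_add, hL' (m+1) hm]; rfl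

end FullTwist

section CoxKer
variable {H : Type*} [Group H]

lemma cox_normal (s : ℕ → H) (n : ℕ)
    (h2 : ∀ i, i < n → s i * s i = 1)
    (hb : ∀ i, i + 1 < n → s i * s (i+1) * s i = s (i+1) * s i * s (i+1))
    (hc : ∀ i j, i + 2 ≤ j → j < n → s i * s j = s j * s i) (m : ℕ) (hm : m + 1 ≤ n)
    (h : H) (hh : h ∈ Subgroup.closure (s '' {i | i < m + 1})) :
    ∃ j len, j + len = m + 1 ∧ ∃ h' ∈ Subgroup.closure (s '' {i | i < m}), h = ascP s j len * h' := by
  have key : ∀ i, i < m + 1 → ∀ y, (∃ j len, j + len = m + 1 ∧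
      ∃ h' ∈ Subgroup.closure (s '' {i | i < m}), y = ascP s j len * h') →
      (∃ j len, j + len = m + 1 ∧ ∃ h' ∈ Subgroup.closure (s '' {i | i < m}), s i * y = ascP s j len * h') := by
    rintro i hi y ⟨j, len, hj, h', hh', rfl⟩
    rcases lt_trichotomy (i+1) j with h | h | h
    · refine ⟨j, len, hj, s i * h', Subgroup.mul_mem _ (Subgroup.subset_closure ⟨i, by simp; omega, rfl⟩) hh', ?_⟩
      rw [← mul_assoc, ascP_comm, mul_assoc]
      intro l hl1 hl2
      exact hc _ _ (by omega) (by omega)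
    · subst h
      exact ⟨i, len+1, by omega, h', hh', by simp [ascP, mul_assoc]⟩
    · by_cases h' : i = j
      · subst h'
        cases len with
        | zero => omega
        | succ len =>
          exact ⟨i+1, len, by omega, h', hh', by rw [ascP, ← mul_assoc, ← mul_assoc, h2 i (by omega), one_mul]⟩
      · refine ⟨j, len, hj, s (i-1) * _, Subgroup.mul_mem _ (Subgroup.subset_closure ⟨i-1, by simp; omega, rfl⟩) hh', ?_⟩
        rw [← mul_assoc, ascP_shift s n hb hc j len i (by omega) (by omega) (by omega), mul_assoc]
  refine Subgroup.closure_induction_left (p := fun x _ => ∃ j len, j + len = m + 1 ∧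
      ∃ h' ∈ Subgroup.closure (s '' {i | i < m}), x = ascP s j len * h') ?_ ?_ ?_ hh
  · exact ⟨m+1, 0, by omega, 1, Subgroup.one_mem _, by simp [ascP]⟩
  · rintro x ⟨i, hi, rfl⟩ y _ hy
    exact key i hi y hy
  · rintro x ⟨i, hi, rfl⟩ y _ hy
    have : (s i)⁻¹ = s i := inv_eq_of_mul_eq_one_left (h2 i (by simp at hi; omega))
    rw [this]
    exact key i hi y hy

lemma cox_ker (s : ℕ → H) (φ : H →* Equiv.Perm ℕ) (hφ : ∀ i, φ (s i) = Equiv.swap i (i+1)) (n : ℕ)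
    (h2 : ∀ i, i < n → s i * s i = 1)
    (hb : ∀ i, i + 1 < n → s i * s (i+1) * s i = s (i+1) * s i * s (i+1))
    (hc : ∀ i j, i + 2 ≤ j → j < n → s i * s j = s j * s i) (m : ℕ) (hm : m ≤ n)
    (h : H) (hh : h ∈ Subgroup.closure (s '' {i | i < m})) (h1 : φ h = 1) : h = 1 := by
  have fixd : ∀ m, ∀ h ∈ Subgroup.closure (s '' {i | i < m}), ∀ x, m < x → φ h x = x := by
    intro m h hh x hx
    induction hh using Subgroup.closure_induction with
    | mem y hy =>
      obtain ⟨i, hi, rfl⟩ := hy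
      simp only [Set.mem_ofPred_eq] at hi
      rw [hφ, Equiv.swap_apply_of_ne_of_ne (by omega) (by omega)]
    | one => simp
    | mul a b _ _ ha hb => simp [ha, hb]
    | inv a _ ha => rw [map_inv, Equiv.Perm.inv_eq_iff_eq, ha]
  have asc : ∀ len j, φ (ascP s j len) (j + len) = j := by
    intro len
    induction len with
    | zero => simp [ascP]
    | succ l ih =>
      intro j
      rw [ascP, map_mul, hφ, Equiv.Perm.mul_apply, show j + (l+1) = (j+1) + l by omega, ih,
        Equiv.swap_apply_right]
  induction m generalizing h with
  | zero => simpa using hh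
  | succ m ih =>
    obtain ⟨j, len, hj, h', hh', rfl⟩ := cox_normal s n h2 hb hc m hm h hh
    have e : φ (ascP s j len * h') (m+1) = m + 1 := by rw [h1]; rfl
    rw [map_mul, Equiv.Perm.mul_apply, fixd m h' hh' (m+1) (by omega), ← hj, asc] at e
    have : len = 0 := by omega
    subst this
    simp only [ascP, one_mul] at h1 ⊢
    exact ih (by omega) h' hh' h1

end CoxKer


/-! ### The (deformed) orthogonal form -/

/-- fillings -/
abbrev Fil := (ℕ × ℕ) → ℕ

/-- the cell containing the value `v` -/
noncomputable def tcell (f : Fil) (v : ℕ) : ℕ × ℕ := Classical.epsilon (fun c => f c = v)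

/-- the content of the cell containing the value `i+1` -/
noncomputable def cnt (f : Fil) (i : ℕ) : ℤ := ((tcell f (i+1)).2 : ℤ) - ((tcell f (i+1)).1 : ℤ)

/-- exchange the values `i+1` and `i+2` -/
def sact (i : ℕ) (f : Fil) : Fil := fun c => Equiv.swap (i+1) (i+2) (f c)

lemma tcell_sact (i : ℕ) (f : Fil) (v : ℕ) :
    tcell (sact i f) v = tcell f (Equiv.swap (i+1) (i+2) v) := by
  unfold tcell sact
  congr 1
  funext c
  rw [Equiv.swap_apply_eq_iff]

lemma cnt_sact_left (i : ℕ) (f : Fil) : cnt (sact i f) i = cnt f (i+1) := by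
  unfold cnt; rw [tcell_sact]; simp

lemma cnt_sact_right (i : ℕ) (f : Fil) : cnt (sact i f) (i+1) = cnt f i := by
  unfold cnt; rw [tcell_sact]; simp

lemma cnt_sact_of_ne (i j : ℕ) (f : Fil) (h1 : j ≠ i) (h2 : j ≠ i + 1) :
    cnt (sact i f) j = cnt f j := by
  unfold cnt; rw [tcell_sact, Equiv.swap_apply_of_ne_of_ne (by omega) (by omega)]

lemma sact_sact (i : ℕ) (f : Fil) : sact i (sact i f) = f := by
  funext c; simp [sact]

lemma sact_comm (i j : ℕ) (h : i + 2 ≤ j) (f : Fil) : sact i (sact j f) = sact j (sact i f) := by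
  funext c
  simp only [sact, Equiv.swap_apply_def]
  split_ifs <;> omega

lemma sact_braid (i : ℕ) (f : Fil) :
    sact i (sact (i+1) (sact i f)) = sact (i+1) (sact i (sact (i+1) f)) := by
  funext c
  simp only [sact, Equiv.swap_apply_def]
  split_ifs <;> omega

/-- Sets of fillings on which the orthogonal form makes sense. -/
structure GoodSet (X : Set Fil) (N : ℕ) : Prop where
  ne1 : ∀ f ∈ X, ∀ i, i + 1 < N → cnt f i ≠ cnt f (i+1)
  ne2 : ∀ f ∈ X, ∀ i, i + 2 < N → cnt f i ≠ cnt f (i+2)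
  sw : ∀ f ∈ X, ∀ i, i + 1 < N → |cnt f (i+1) - cnt f i| ≠ 1 → sact i f ∈ X

/-- the operator on functions on all fillings -/
def opF (a β : Fil → ℝ) (i : ℕ) (v : Fil → ℝ) : Fil → ℝ := fun f => a f * v f + β f * v (sact i f)

open Classical in
/-- the corresponding matrix on `X` -/
noncomputable def opM (X : Set Fil) (a β : Fil → ℝ) (i : ℕ) : Matrix X X ℝ :=
  Matrix.of fun f h => (if h = f then a f.1 else 0) + (if h.1 = sact i f.1 then β f.1 else 0)

section
variable {X : Set Fil} [Fintype X]

lemma opM_mulVec (a β : Fil → ℝ) (i : ℕ) (hβ : ∀ f ∈ X, β f ≠ 0 → sact i f ∈ X) (v : Fil → ℝ) :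
    (opM X a β i).mulVec (fun f => v f.1) = fun f => opF a β i v f.1 := by
  classical
  funext f
  simp only [Matrix.mulVec, dotProduct, opM, Matrix.of_apply, add_mul, Finset.sum_add_distrib, opF]
  congr 1
  · rw [Finset.sum_eq_single f]
    · simp
    · intro b _ hb; simp [hb]
    · simp
  · by_cases hb : β f.1 = 0
    · simp [hb]
    · have := hβ f.1 f.2 hb
      rw [Finset.sum_eq_single ⟨_, this⟩]
      · simp
      · intro b _ hb
        rw [if_neg, zero_mul]
        intro h; apply hb; ext1; exact h
      · simp

lemma mat_ext_mulVec {M M' : Matrix X X ℝ}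
    (h : ∀ v : Fil → ℝ, M.mulVec (fun f => v f.1) = M'.mulVec (fun f => v f.1)) : M = M' := by
  classical
  apply Matrix.ext_of_mulVec_single
  intro j
  have e : (Pi.single j 1 : X → ℝ) = fun f => (fun f : Fil => if f = j.1 then (1 : ℝ) else 0) f.1 := by
    funext f
    simp [Pi.single_apply, Subtype.ext_iff]
  rw [e]
  exact h (fun f : Fil => if f = j.1 then (1 : ℝ) else 0)

end

/-- axioms for the coefficients -/
structure ABax (A B : ℤ → ℤ → ℝ) (h : ℝ) : Prop where
  sum : ∀ x y, x ≠ y → A x y + A y x = h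
  tri : ∀ x y z, x ≠ y → y ≠ z → x ≠ z → A x y * A y z = A x z * (A x y + A y z - h)
  bsq : ∀ x y, x ≠ y → B x y * B x y = 1 + A x y * A y x
  bsym : ∀ x y, B x y = B y x
  b1 : ∀ x y, |y - x| = 1 → B x y = 0

/-- the matrix with coefficients `A`, `B` -/
noncomputable def abM (X : Set Fil) (A B : ℤ → ℤ → ℝ) (i : ℕ) : Matrix X X ℝ :=
  opM X (fun f => A (cnt f i) (cnt f (i+1))) (fun f => B (cnt f i) (cnt f (i+1))) i

/-- its lift to all functions -/
noncomputable def abF (A B : ℤ → ℤ → ℝ) (i : ℕ) (v : Fil → ℝ) : Fil → ℝ :=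
  opF (fun f => A (cnt f i) (cnt f (i+1))) (fun f => B (cnt f i) (cnt f (i+1))) i v

section
variable {X : Set Fil} [Fintype X] {N : ℕ}

lemma abM_mulVec (hX : GoodSet X N) {A B : ℤ → ℤ → ℝ} (b1 : ∀ x y, |y - x| = 1 → B x y = 0)
    (i : ℕ) (hi : i + 1 < N) (v : Fil → ℝ) :
    (abM X A B i).mulVec (fun f => v f.1) = fun f => abF A B i v f.1 := by
  apply opM_mulVec
  intro f hf hb
  apply hX.sw f hf i hi
  intro h
  exact hb (b1 _ _ h)

lemma abM_braid (hX : GoodSet X N) {A B : ℤ → ℤ → ℝ} {h : ℝ} (ax : ABax A B h) (i : ℕ) (hi : i + 2 < N) :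
    abM X A B i * abM X A B (i+1) * abM X A B i = abM X A B (i+1) * abM X A B i * abM X A B (i+1) := by
  apply mat_ext_mulVec
  intro v
  simp only [← Matrix.mulVec_mulVec]
  rw [abM_mulVec hX ax.b1 i (by omega), abM_mulVec hX ax.b1 (i+1) (by omega),
    abM_mulVec hX ax.b1 i (by omega), abM_mulVec hX ax.b1 (i+1) (by omega),
    abM_mulVec hX ax.b1 i (by omega), abM_mulVec hX ax.b1 (i+1) (by omega)]
  funext ⟨f, hf⟩
  have n1 := hX.ne1 f hf i (by omega)
  have n2 := hX.ne1 f hf (i+1) (by omega)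
  have n3 := hX.ne2 f hf i (by omega)
  have e0 : ∀ g, cnt (sact i g) (i+1+1) = cnt g (i+1+1) := fun g => cnt_sact_of_ne _ _ _ (by omega) (by omega)
  have e1 : ∀ g, cnt (sact (i+1) g) i = cnt g i := fun g => cnt_sact_of_ne _ _ _ (by omega) (by omega)
  simp only [abF, opF, cnt_sact_left, cnt_sact_right, e0, e1, sact_sact, sact_braid]
  generalize cnt f i = x at *
  generalize cnt f (i+1) = y at *
  rw [show i + 1 + 1 = i + 2 from rfl] at *
  generalize cnt f (i+2) = z at *
  have s1 := ax.sum x y n1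
  have s2 := ax.sum y z n2
  have s3 := ax.sum x z n3
  have t := ax.tri x y z n1 n2 n3
  have b1 := ax.bsq x y n1
  have b2 := ax.bsq y z n2
  rw [ax.bsym y x, ax.bsym z y]
  have a1 : A y x = h - A x y := by linarith
  have a2 : A z y = h - A y z := by linarith
  rw [a1] at b1
  rw [a2] at b2
  rw [a1, a2]
  generalize v (sact (i+1) (sact i (sact (i+1) f))) = v1
  generalize v (sact (i+1) (sact i f)) = v2
  generalize v (sact i (sact (i+1) f)) = v3
  generalize v (sact i f) = v4
  generalize v (sact (i+1) f) = v5
  generalize v f = v6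
  generalize A x y = p at *
  generalize A y z = q at *
  generalize A x z = r at *
  generalize B x y = P at *
  generalize B y z = Q at *
  generalize B x z = R at *
  linear_combination (v6 * (p - q) + v4 * P - v5 * Q) * t + v6 * r * b1 - v6 * r * b2

lemma abM_comm (hX : GoodSet X N) {A B : ℤ → ℤ → ℝ} (b1 : ∀ x y, |y - x| = 1 → B x y = 0)
    (i j : ℕ) (hij : i + 2 ≤ j) (hj : j + 1 < N) :
    abM X A B i * abM X A B j = abM X A B j * abM X A B i := by
  apply mat_ext_mulVec
  intro v
  simp only [← Matrix.mulVec_mulVec]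
  rw [abM_mulVec hX b1 i (by omega), abM_mulVec hX b1 j (by omega),
    abM_mulVec hX b1 i (by omega), abM_mulVec hX b1 j (by omega)]
  funext ⟨f, hf⟩
  simp only [abF, opF]
  rw [cnt_sact_of_ne i j _ (by omega) (by omega), cnt_sact_of_ne i (j+1) _ (by omega) (by omega),
    cnt_sact_of_ne j i _ (by omega) (by omega), cnt_sact_of_ne j (i+1) _ (by omega) (by omega),
    sact_comm i j hij]
  ring

lemma abM_sq [DecidableEq X] (hX : GoodSet X N) {A B : ℤ → ℤ → ℝ} (ax : ABax A B 0) (i : ℕ) (hi : i + 1 < N) :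
    abM X A B i * abM X A B i = 1 := by
  apply mat_ext_mulVec
  intro v
  simp only [← Matrix.mulVec_mulVec, Matrix.one_mulVec]
  rw [abM_mulVec hX ax.b1 i (by omega), abM_mulVec hX ax.b1 i (by omega)]
  funext ⟨f, hf⟩
  have n1 := hX.ne1 f hf i (by omega)
  simp only [abF, opF, cnt_sact_left, cnt_sact_right, sact_sact]
  generalize cnt f i = x at *
  generalize cnt f (i+1) = y at *
  have s1 := ax.sum x y n1
  have b1 := ax.bsq x y n1
  rw [ax.bsym y x]
  linear_combination v f * b1 + v f * A x y * s1 + B x y * v (sact i f) * s1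

/-- diagonal matrices of functions of contents -/
noncomputable def dgM (X : Set Fil) [DecidableEq X] (k : ℤ → ℝ) (j : ℕ) : Matrix X X ℝ :=
  Matrix.diagonal fun f => k (cnt f.1 j)

/-- lift of `dgM` -/
noncomputable def dgF (k : ℤ → ℝ) (j : ℕ) (v : Fil → ℝ) : Fil → ℝ := fun f => k (cnt f j) * v f

lemma dgM_mulVec [DecidableEq X] (k : ℤ → ℝ) (j : ℕ) (v : Fil → ℝ) :
    (dgM X k j).mulVec (fun f => v f.1) = fun f => dgF k j v f.1 := by
  funext f
  rw [dgM, Matrix.mulVec_diagonal]; rfl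

lemma abM_JM [DecidableEq X] (hX : GoodSet X N) {A B : ℤ → ℤ → ℝ} {h : ℝ} (ax : ABax A B h) (k : ℤ → ℝ)
    (hk : ∀ x y, x ≠ y → k x * A x y + k y * A y x = 0) (i : ℕ) (hi : i + 1 < N) :
    abM X A B i * dgM X k i * abM X A B i = dgM X k (i+1) := by
  apply mat_ext_mulVec
  intro v
  simp only [← Matrix.mulVec_mulVec]
  rw [abM_mulVec hX ax.b1 i (by omega), dgM_mulVec, abM_mulVec hX ax.b1 i (by omega), dgM_mulVec]
  funext ⟨f, hf⟩
  have n1 := hX.ne1 f hf i (by omega)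
  simp only [abF, opF, dgF, cnt_sact_left, cnt_sact_right, sact_sact]
  generalize cnt f i = x at *
  generalize cnt f (i+1) = y at *
  have s1 := ax.sum x y n1
  have b1 := ax.bsq x y n1
  have hk := hk x y n1
  rw [ax.bsym y x]
  linear_combination k y * v f * b1 + (v f * A x y + B x y * v (sact i f)) * hk

lemma abM_conj [DecidableEq X] (hX : GoodSet X N) {A A' B : ℤ → ℤ → ℝ}
    (b1 : ∀ x y, |y - x| = 1 → B x y = 0) (k : ℤ → ℝ)
    (hk : ∀ x y, A x y * k y = k x * A' x y) (i : ℕ) (hi : i + 1 < N) :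
    abM X A B i * dgM X k (i+1) = dgM X k i * abM X A' B i := by
  apply mat_ext_mulVec
  intro v
  simp only [← Matrix.mulVec_mulVec]
  rw [abM_mulVec hX b1 i (by omega), dgM_mulVec, abM_mulVec hX b1 i (by omega), dgM_mulVec]
  funext ⟨f, hf⟩
  simp only [abF, opF, dgF, cnt_sact_right]
  generalize cnt f i = x at *
  generalize cnt f (i+1) = y at *
  have hk := hk x y
  linear_combination v f * hk

end


/-! ### The deformation parameter -/

/-- `1/[a]_q` for the balanced `q`-integer -/
noncomputable def rq (q : ℝ) (a : ℤ) : ℝ :=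
  (a.sign : ℝ) * (q ^ (a.natAbs - 1) / ∑ j ∈ Finset.range a.natAbs, q ^ (2*j))

lemma rq_den (q : ℝ) (m : ℕ) (hm : 0 < m) : 1 ≤ ∑ j ∈ Finset.range m, q ^ (2*j) := by
  have : q^(2*0) ≤ ∑ j ∈ Finset.range m, q ^ (2*j) :=
    Finset.single_le_sum (f := fun j => q^(2*j)) (fun j _ => by rw [pow_mul]; positivity) (Finset.mem_range.2 hm)
  simpa using this

lemma rq_continuous (a : ℤ) : Continuous (fun q => rq q a) := by
  unfold rq
  by_cases h : a = 0
  · subst h; simpa using continuous_const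
  · apply Continuous.mul continuous_const
    apply Continuous.div (by fun_prop) (by fun_prop)
    intro q
    have := rq_den q a.natAbs (by omega)
    positivity

lemma rq_neg (q : ℝ) (a : ℤ) : rq q (-a) = - rq q a := by
  simp [rq]

lemma rq_abs_one (q : ℝ) (a : ℤ) (h : |a| = 1) : rq q a = a := by
  have : a = 1 ∨ a = -1 := (abs_eq zero_le_one).1 h
  rcases this with h | h <;> subst h <;> simp [rq]

lemma rq_sq_le (q : ℝ) (h0 : 0 ≤ q) (h1 : q ≤ 1) (a : ℤ) : rq q a * rq q a ≤ 1 := by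
  by_cases h : a = 0
  · subst h; simp [rq]
  have hd := rq_den q a.natAbs (by omega)
  have hn : q ^ (a.natAbs - 1) ≤ 1 := pow_le_one₀ h0 h1
  have hn0 : 0 ≤ q ^ (a.natAbs - 1) := by positivity
  have hs : ((a.sign : ℤ) : ℝ) * a.sign = 1 := by
    rcases lt_or_gt_of_ne h with h | h
    · rw [Int.sign_eq_neg_one_of_neg h]; norm_num
    · rw [Int.sign_eq_one_of_pos h]; norm_num
  set u := q ^ (a.natAbs - 1) / ∑ j ∈ Finset.range a.natAbs, q ^ (2*j) with hu
  have u0 : 0 ≤ u := by positivity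
  have u1 : u ≤ 1 := by rw [hu, div_le_one (by linarith)]; linarith
  have : rq q a * rq q a = u * u := by
    unfold rq; rw [← hu]; linear_combination u * u * hs
  rw [this]; nlinarith

lemma rq_one (a : ℤ) : rq 1 a = 1 / a := by
  unfold rq
  simp only [one_pow, Finset.sum_const, Finset.card_range, nsmul_eq_mul, mul_one]
  rcases lt_trichotomy a 0 with h | h | h
  · rw [Int.sign_eq_neg_one_of_neg h]
    have : (a.natAbs : ℝ) = -(a : ℝ) := by
      rw [Nat.cast_natAbs, abs_of_neg h]; push_cast; rfl
    rw [this, one_div, one_div, inv_neg]; push_cast; ring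
  · subst h; simp
  · rw [Int.sign_eq_one_of_pos h]
    have : (a.natAbs : ℝ) = (a : ℝ) := by
      rw [Nat.cast_natAbs, abs_of_pos h]
    rw [this]; simp

lemma rq_zero (a : ℤ) (h : |a| ≠ 1) : rq 0 a = 0 := by
  unfold rq
  by_cases h0 : a = 0
  · subst h0; simp
  have h1 : a.natAbs ≠ 1 := fun hh => h (by rw [Int.abs_eq_natAbs, hh]; rfl)
  rw [zero_pow (by omega)]; simp

lemma rq_pos (q : ℝ) (h0 : 0 < q) (h1 : q < 1) (m : ℕ) (hm : 0 < m) :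
    rq q m * (q ^ m - (q ^ m)⁻¹) = q - q⁻¹ := by
  unfold rq
  have hs : ∑ j ∈ Finset.range m, q ^ (2*j) = ((q^2)^m - 1) / (q^2 - 1) := by
    rw [← geom_sum_eq (by nlinarith)]
    simp [pow_mul]
  have e1 : q^2 - 1 ≠ 0 := by nlinarith
  have e2 : (q^2)^m - 1 ≠ 0 := by
    have : (q^2)^m < 1 := pow_lt_one₀ (by positivity) (by nlinarith) (by omega)
    linarith
  simp only [Int.natAbs_natCast, hs, Int.sign_natCast_of_ne_zero (by omega : m ≠ 0)]
  obtain ⟨m, rfl⟩ : ∃ k, m = k + 1 := ⟨m - 1, by omega⟩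
  simp only [Nat.add_sub_cancel]
  have e3 : (q^2)^(m+1) = q^m * q^m * q^2 := by ring
  rw [e3] at e2 ⊢
  have e4 : q ^ (m+1) = q^m * q := by ring
  rw [e4]
  have : q^m ≠ 0 := by positivity
  clear hs
  generalize q^m = t at *
  push_cast
  have hq : q ≠ 0 := h0.ne'
  have e5 : t * q - (t*q)⁻¹ = (t*t*q^2-1)/(t*q) := by field_simp
  have e6 : q - q⁻¹ = (q^2-1)/q := by field_simp
  rw [e5, e6]
  generalize t*t*q^2-1 = A at *
  generalize q^2-1 = B at *
  field_simp

lemma rq_zpow (q : ℝ) (h0 : 0 < q) (h1 : q < 1) (a : ℤ) (ha : a ≠ 0) :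
    rq q a * (q ^ a - q ^ (-a)) = q - q⁻¹ := by
  rcases lt_or_gt_of_ne ha with h | h
  · obtain ⟨m, rfl⟩ : ∃ m : ℕ, a = -m := ⟨a.natAbs, by omega⟩
    rw [rq_neg, neg_neg]
    have := rq_pos q h0 h1 m (by omega)
    simp only [zpow_neg, zpow_natCast] at *
    linarith
  · obtain ⟨m, rfl⟩ : ∃ m : ℕ, a = m := ⟨a.natAbs, by omega⟩
    have := rq_pos q h0 h1 m (by omega)
    simp only [zpow_neg, zpow_natCast] at *
    linarith

/-- off-diagonal coefficient -/
noncomputable def Bq (q : ℝ) (x y : ℤ) : ℝ := √(1 - rq q (y - x) * rq q (y - x))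

/-- diagonal coefficient of the orthogonalised generators -/
noncomputable def Rq (q : ℝ) (x y : ℤ) : ℝ := rq q (y - x)

/-- diagonal coefficient of the Hecke generators -/
noncomputable def Aq (q : ℝ) (x y : ℤ) : ℝ := q ^ (y - x) * rq q (y - x)

lemma Bq_sym (q : ℝ) (x y : ℤ) : Bq q x y = Bq q y x := by
  unfold Bq
  rw [← neg_sub y x, rq_neg]; simp

lemma Bq_one (q : ℝ) (x y : ℤ) (h : |y - x| = 1) : Bq q x y = 0 := by
  unfold Bq
  rw [rq_abs_one q _ h]
  have : y - x = 1 ∨ y - x = -1 := (abs_eq zero_le_one).1 h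
  rcases this with h | h <;> rw [h] <;> simp

lemma Bq_sq (q : ℝ) (h0 : 0 ≤ q) (h1 : q ≤ 1) (x y : ℤ) :
    Bq q x y * Bq q x y = 1 - rq q (y - x) * rq q (y - x) := by
  unfold Bq
  rw [Real.mul_self_sqrt]
  have := rq_sq_le q h0 h1 (y - x)
  linarith

lemma Aq_eq (q : ℝ) (h0 : 0 < q) (h1 : q < 1) (x y : ℤ) (h : x ≠ y) :
    (q^y * q^y - q^x * q^x) ≠ 0 ∧
    Aq q x y = (q - q⁻¹) * (q^y * q^y) / (q^y * q^y - q^x * q^x) := by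
  have hx : q^x ≠ 0 := by positivity
  have hy : q^y ≠ 0 := by positivity
  have hz := rq_zpow q h0 h1 (y - x) (by omega)
  have hne : q - q⁻¹ ≠ 0 := by
    have : 1 < q⁻¹ := (one_lt_inv₀ h0).2 h1
    linarith
  have e : q ^ (y - x) - q ^ (-(y-x)) = (q^y * q^y - q^x * q^x) / (q^x * q^y) := by
    rw [neg_sub, zpow_sub₀ h0.ne', zpow_sub₀ h0.ne']
    field_simp
  have hd : (q^y * q^y - q^x * q^x) ≠ 0 := by
    intro hd
    rw [e, hd] at hz
    simp at hz
    exact hne hz.symm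
  refine ⟨hd, ?_⟩
  unfold Aq
  rw [e] at hz
  rw [eq_div_iff hd, zpow_sub₀ h0.ne']
  rw [← hz]
  field_simp

lemma ABax_q (q : ℝ) (h0 : 0 < q) (h1 : q < 1) : ABax (Aq q) (Bq q) (q - q⁻¹) where
  sum := by
    intro x y h
    obtain ⟨d1, e1⟩ := Aq_eq q h0 h1 x y h
    obtain ⟨d2, e2⟩ := Aq_eq q h0 h1 y x h.symm
    rw [e1, e2]
    generalize q - q⁻¹ = w
    generalize q^x * q^x = X at *
    generalize q^y * q^y = Y at *
    rw [div_add_div _ _ d1 d2, div_eq_iff (mul_ne_zero d1 d2)]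
    ring
  tri := by
    intro x y z h h' h''
    obtain ⟨d1, e1⟩ := Aq_eq q h0 h1 x y h
    obtain ⟨d2, e2⟩ := Aq_eq q h0 h1 y z h'
    obtain ⟨d3, e3⟩ := Aq_eq q h0 h1 x z h''
    rw [e1, e2, e3]
    generalize q - q⁻¹ = w
    generalize q^x * q^x = X at *
    generalize q^y * q^y = Y at *
    generalize q^z * q^z = Z at *
    have e4 : w * Y / (Y - X) + w * Z / (Z - Y) - w = w * Y * (Z - X) / ((Y - X) * (Z - Y)) := by
      rw [div_add_div _ _ d1 d2, div_sub' (mul_ne_zero d1 d2)]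
      congr 1; ring
    rw [e4, div_mul_div_comm, div_mul_div_comm, div_eq_div_iff (mul_ne_zero d1 d2) (mul_ne_zero d3 (mul_ne_zero d1 d2))]
    ring
  bsq := by
    intro x y h
    rw [Bq_sq q h0.le h1.le]
    unfold Aq
    rw [← neg_sub y x, rq_neg, zpow_neg]
    have : q ^ (y - x) ≠ 0 := by positivity
    field_simp
    ring
  bsym := Bq_sym q
  b1 := Bq_one q

lemma ABax_one : ABax (Rq 1) (Bq 1) 0 where
  sum := by
    intro x y h
    simp only [Rq]
    rw [← neg_sub y x, rq_neg]; ring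
  tri := by
    intro x y z h h' h''
    simp only [Rq, rq_one]
    have e1 : ((y - x : ℤ) : ℝ) ≠ 0 := by exact_mod_cast sub_ne_zero.2 h.symm
    have e2 : ((z - y : ℤ) : ℝ) ≠ 0 := by exact_mod_cast sub_ne_zero.2 h'.symm
    have e3 : ((z - x : ℤ) : ℝ) ≠ 0 := by exact_mod_cast sub_ne_zero.2 h''.symm
    push_cast at *
    field_simp
    ring
  bsq := by
    intro x y h
    rw [Bq_sq 1 zero_le_one le_rfl]
    simp only [Rq]
    rw [← neg_sub y x, rq_neg]; ring
  bsym := Bq_sym 1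
  b1 := Bq_one 1

/-- the orthogonal generators -/
noncomputable def Rm (X : Set Fil) (q : ℝ) (i : ℕ) : Matrix X X ℝ := abM X (Rq q) (Bq q) i

lemma Rm_continuous (X : Set Fil) (i : ℕ) : Continuous (fun q => Rm X q i) := by
  apply continuous_matrix
  intro f h
  have hr := rq_continuous
  simp only [Rm, abM, opM, Matrix.of_apply, Rq, Bq]
  apply Continuous.add
  · split_ifs
    · exact hr _
    · exact continuous_const
  · split_ifs
    · exact Real.continuous_sqrt.comp (continuous_const.sub ((hr _).mul (hr _)))
    · exact continuous_const

section
variable {X : Set Fil} [Fintype X] [DecidableEq X] {N : ℕ}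

/-- deformed long cycle -/
noncomputable def Pm (X : Set Fil) [Fintype X] [DecidableEq X] (N : ℕ) (q : ℝ) : Matrix X X ℝ :=
  ascP (Rm X q) 0 (N-1)

lemma ascP_continuous {T : ℝ → ℕ → Matrix X X ℝ} (h : ∀ i, Continuous (fun q => T q i)) (a len : ℕ) :
    Continuous (fun q => ascP (T q) a len) := by
  induction len generalizing a with
  | zero => simpa [ascP] using continuous_const
  | succ l ih => simp only [ascP]; exact (h a).mul (ih _)

lemma Pm_continuous : Continuous (Pm X N) := ascP_continuous (T := Rm X) (Rm_continuous X) 0 _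

lemma ascP_diag (k : ℤ → ℝ) (a len : ℕ) :
    ascP (dgM X k) a len = Matrix.diagonal (fun f => ∏ j ∈ Finset.range len, k (cnt f.1 (a + j))) := by
  induction len generalizing a with
  | zero => simp [ascP]
  | succ l ih =>
    rw [ascP, ih, dgM, Matrix.diagonal_mul_diagonal]
    congr 1; funext f
    rw [Finset.prod_range_succ', mul_comm]
    congr 1
    apply Finset.prod_congr rfl; intros; congr 2; omega

lemma Pm_pow (hX : GoodSet X N) (hN : 0 < N) (e : ℤ) (h0 : ∀ f ∈ X, cnt f 0 = 0)
    (h1 : ∀ f ∈ X, cnt f (N-1) = e) (h2 : ∀ f ∈ X, 2 * ∑ i ∈ Finset.range N, cnt f i = N * e)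
    (q : ℝ) (hq0 : 0 < q) (hq1 : q < 1) : (Pm X N q)^N = 1 := by
  have ax := ABax_q q hq0 hq1
  set T := abM X (Aq q) (Bq q) with hT
  have key : ∀ m, m + 1 ≤ N → ascP (Rm X q) 0 m * dgM X (fun x => q ^ x) m = ascP T 0 m := by
    intro m
    induction m with
    | zero =>
      intro _
      simp only [ascP, one_mul]
      rw [dgM, ← Matrix.diagonal_one]
      congr 1; funext f; simp [h0 f.1 f.2]
    | succ m ih =>
      intro hm
      rw [ascP_succ_right, mul_assoc, zero_add, Rm,
        abM_conj hX (A' := Aq q) ax.b1 (fun x => q^x) ?_ m (by omega), ← mul_assoc, ih (by omega),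
        ascP_succ_right, zero_add]
      intro x y
      simp only [Rq, Aq]
      rw [zpow_sub₀ hq0.ne']
      have : q^x ≠ 0 := by positivity
      field_simp
  have k1 := key (N-1) (by omega)
  have hd : dgM X (fun x => q^x) (N-1) = (q^e) • (1 : Matrix X X ℝ) := by
    rw [dgM, Matrix.smul_one_eq_diagonal]
    congr 1; funext f; simp [h1 f.1 f.2]
  rw [hd, mul_smul_comm, mul_one] at k1
  have ft := fullTwist T (dgM X (fun x => q^x * q^x)) (N-1)
    (fun i hi => abM_braid hX ax i (by omega)) (fun i j hij hj => abM_comm hX ax.b1 i j hij (by omega))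
    (by
      rw [dgM, ← Matrix.diagonal_one]
      congr 1; funext f; simp [h0 f.1 f.2])
    (by
      intro i hi
      apply abM_JM hX ax _ _ i (by omega)
      intro x y h
      obtain ⟨d1, e1⟩ := Aq_eq q hq0 hq1 x y h
      obtain ⟨d2, e2⟩ := Aq_eq q hq0 hq1 y x h.symm
      rw [e1, e2]
      generalize q - q⁻¹ = w
      clear e1 e2
      generalize q^x * q^x = U at *
      generalize q^y * q^y = V at *
      field_simp
      ring) (N-1) le_rfl
  rw [← k1, Nat.sub_add_cancel hN, smul_pow, ascP_diag] at ft
  have hr : (Matrix.diagonal (fun f : X => ∏ j ∈ Finset.range N, (q ^ (cnt f.1 (0 + j)) * q ^ (cnt f.1 (0 + j)))))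
      = (q^e)^N • (1 : Matrix X X ℝ) := by
    rw [Matrix.smul_one_eq_diagonal]
    congr 1; funext f
    simp only [zero_add, Finset.prod_mul_distrib]
    have : ∏ j ∈ Finset.range N, q ^ (cnt f.1 j) = q ^ (∑ j ∈ Finset.range N, cnt f.1 j) := by
      generalize Finset.range N = S
      induction S using Finset.induction_on with
      | empty => simp
      | insert a S ha ih => rw [Finset.prod_insert ha, ih, Finset.sum_insert ha, zpow_add₀ hq0.ne']
    rw [this, ← zpow_add₀ hq0.ne', ← zpow_natCast, ← zpow_mul, ← two_mul, h2 f.1 f.2, mul_comm]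
  rw [hr] at ft
  have hne : (q^e)^N ≠ 0 := by positivity
  exact smul_right_injective _ hne ft

end

/-! ### Constancy of the trace -/

section
variable {n : Type*} [Fintype n] [DecidableEq n]

lemma trace_finite (N : ℕ) (hN : 0 < N) :
    {t : ℝ | ∃ M : Matrix n n ℝ, M ^ N = 1 ∧ M.trace = t}.Finite := by
  classical
  let F : Finset ℂ := (Polynomial.nthRoots N (1:ℂ)).toFinset
  have hfin : ((fun s : Multiset ℂ => s.sum.re) '' (Set.Iic (Fintype.card n • F.val))).Finite :=
    (Set.finite_Iic _).image _
  apply hfin.subset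
  rintro t ⟨M, hM, rfl⟩
  let A : Matrix n n ℂ := M.map (Complex.ofRealHom)
  have hA : A ^ N = 1 := by
    have := congrArg (fun B : Matrix n n ℝ => B.map Complex.ofRealHom) hM
    beta_reduce at this
    rw [Matrix.map_pow, Matrix.map_one _ (map_zero _) (map_one _)] at this
    exact this
  refine ⟨A.charpoly.roots, ?_, ?_⟩
  · rw [Set.mem_Iic, Multiset.le_iff_count]
    intro a
    by_cases ha : a ∈ A.charpoly.roots
    · have haF : a ∈ F := by
        rw [Multiset.mem_toFinset, Polynomial.mem_nthRoots hN]
        have hroot : A.charpoly.IsRoot a := (Polynomial.mem_roots'.1 ha).2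
        have hev : Module.End.HasEigenvalue (Matrix.toLin' A) a := by
          rw [Module.End.hasEigenvalue_iff_isRoot_charpoly, Matrix.charpoly_toLin']
          exact hroot
        obtain ⟨v, hv⟩ := hev.exists_hasEigenvector
        have := hv.pow_apply N
        rw [← Matrix.toLin'_pow, hA, Matrix.toLin'_one] at this
        have h2 : (1 : ℂ) • v = (a^N) • v := by simpa using this
        exact (smul_left_injective ℂ hv.2 h2).symm
      have c1 : Multiset.count a (Fintype.card n • F.val) = Fintype.card n := by
        rw [Multiset.count_nsmul, Multiset.count_eq_one_of_mem F.nodup haF, mul_one]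
      rw [c1]
      refine (Multiset.count_le_card _ _).trans ((Polynomial.card_roots' _).trans ?_)
      rw [Matrix.charpoly_natDegree_eq_dim]
    · rw [Multiset.count_eq_zero_of_notMem ha]; omega
  · simp only
    rw [← Matrix.trace_eq_sum_roots_charpoly]
    simp [A, Matrix.trace]

lemma trace_const (P : ℝ → Matrix n n ℝ) (hP : Continuous P) (N : ℕ) (hN : 0 < N)
    (h : ∀ q, 0 < q → q < 1 → P q ^ N = 1) (d : ℕ) :
    ((P 0)^d).trace = ((P 1)^d).trace ∧ P 0 ^ N = 1 := by
  have hc : ∀ d, Continuous (fun q => (P q)^d) := fun d => hP.pow d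
  have ht : Continuous (fun q => ((P q)^d).trace) := (hc d).matrix_trace
  have hcl : closure (Set.Ioo (0:ℝ) 1) = Set.Icc 0 1 := closure_Ioo (by norm_num)
  constructor
  · have hf := trace_finite (n := n) N hN
    have hpre : ((fun q => ((P q)^d).trace) '' (Set.Ioo (0:ℝ) 1)).Subsingleton := by
      have h1 := (isPreconnected_Ioo (a := (0:ℝ)) (b := 1)).image _ ht.continuousOn
      have h2 : ((fun q => ((P q)^d).trace) '' (Set.Ioo (0:ℝ) 1)).Finite := by
        apply hf.subset
        rintro _ ⟨q, hq, rfl⟩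
        refine ⟨(P q)^d, ?_, rfl⟩
        rw [← pow_mul, mul_comm, pow_mul, h q hq.1 hq.2, one_pow]
      by_contra hns
      rw [Set.not_subsingleton_iff] at hns
      exact (h1.infinite_of_nontrivial hns) h2
    have hcon : ∀ q ∈ Set.Ioo (0:ℝ) 1, ((P q)^d).trace = ((P (1/2))^d).trace := by
      intro q hq
      exact hpre ⟨q, hq, rfl⟩ ⟨1/2, by norm_num, rfl⟩
    have hcon2 : Set.EqOn (fun q => ((P q)^d).trace) (fun _ => ((P (1/2))^d).trace)
        (closure (Set.Ioo (0:ℝ) 1)) :=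
      Set.EqOn.closure hcon ht continuous_const
    rw [hcl] at hcon2
    exact (hcon2 (by simp : (0:ℝ) ∈ _)).trans (hcon2 (by simp : (1:ℝ) ∈ _)).symm
  · have : Set.EqOn (fun q => P q ^ N) (fun _ => 1) (closure (Set.Ioo (0:ℝ) 1)) :=
      Set.EqOn.closure (fun q hq => h q hq.1 hq.2) (hc N) continuous_const
    rw [hcl] at this
    exact this (by simp : (0:ℝ) ∈ _)

end


/-! ### Standard fillings of order ideals -/

/-- order ideals in the quarter plane -/
structure IsIdeal (C : ℕ × ℕ → Prop) : Prop where
  up : ∀ a b, C (a+1, b) → C (a, b)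
  left : ∀ a b, C (a, b+1) → C (a, b)

/-- the set of standard fillings -/
def SF (C : ℕ × ℕ → Prop) (N : ℕ) : Set Fil := {f | IsStdFilling C N f}

lemma IsIdeal.mono {C : ℕ × ℕ → Prop} (hC : IsIdeal C) {a b a' b' : ℕ} (ha : a ≤ a') (hb : b ≤ b')
    (h : C (a', b')) : C (a, b) := by
  have h1 : C (a, b') := by
    induction a', ha using Nat.le_induction with
    | base => exact h
    | succ m _ ih => exact ih (hC.up _ _ h)
  clear h
  induction b', hb using Nat.le_induction with
  | base => exact h1
  | succ m _ ih => exact ih (hC.left _ _ h1)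

namespace SFl
variable {C : ℕ × ℕ → Prop} {N : ℕ} {f : Fil}

lemma tcell_spec (hf : IsStdFilling C N f) {v : ℕ} (h1 : 1 ≤ v) (h2 : v ≤ N) :
    C (tcell f v) ∧ f (tcell f v) = v := by
  obtain ⟨c, hc, hv⟩ := hf.2.2.2.1 v h1 h2
  have : f (tcell f v) = v := Classical.epsilon_spec (p := fun c => f c = v) ⟨c, hv⟩
  refine ⟨?_, this⟩
  by_contra h
  have := hf.1 _ h
  omega

lemma cell_of_pos (hf : IsStdFilling C N f) {c : ℕ × ℕ} (h : f c ≠ 0) : C c := by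
  by_contra h'
  exact h (hf.1 _ h')

lemma tcell_eq (hf : IsStdFilling C N f) {c : ℕ × ℕ} {v : ℕ} (hv : f c = v) (h1 : 1 ≤ v) :
    tcell f v = c := by
  have hc : C c := cell_of_pos hf (by omega)
  have := tcell_spec hf h1 (hv ▸ (hf.2.1 c hc).2)
  exact hf.2.2.1 _ _ this.1 hc (by rw [this.2, hv])

lemma le_row (hC : IsIdeal C) (hf : IsStdFilling C N f) (a b m : ℕ) (h : C (a, b+m)) : f (a,b) + m ≤ f (a, b+m) := by
  induction m with
  | zero => simp
  | succ m ih =>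
    have h1 : C (a, b+m) := hC.left _ _ h
    have := hf.2.2.2.2.1 a (b+m) h1 h
    have := ih h1
    rw [show b + (m+1) = b + m + 1 by omega]
    omega

lemma le_col (hC : IsIdeal C) (hf : IsStdFilling C N f) (a b m : ℕ) (h : C (a+m, b)) : f (a,b) + m ≤ f (a+m, b) := by
  induction m with
  | zero => simp
  | succ m ih =>
    have h1 : C (a+m, b) := hC.up _ _ h
    have := hf.2.2.2.2.2 (a+m) b h1 h
    have := ih h1
    rw [show a + (m+1) = a + m + 1 by omega]
    omega

lemma le_both (hC : IsIdeal C) (hf : IsStdFilling C N f) (a b m l : ℕ) (h : C (a+m, b+l)) :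
    f (a,b) + m + l ≤ f (a+m, b+l) := by
  have h1 := le_row hC hf (a+m) b l h
  have h2 := le_col hC hf a b m (hC.mono le_rfl (by omega) h)
  omega

lemma diag (hC : IsIdeal C) (hf : IsStdFilling C N f) (a b m : ℕ) (hm : 0 < m) (h : C (a+m, b+m)) :
    f (a,b) + 3 ≤ f (a+m, b+m) := by
  have c11 : C (a+1, b+1) := hC.mono (by omega) (by omega) h
  have c01 : C (a, b+1) := hC.mono (by omega) (by omega) h
  have c10 : C (a+1, b) := hC.mono (by omega) (by omega) h
  have c00 : C (a, b) := hC.mono (by omega) (by omega) h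
  have e1 := hf.2.2.2.2.1 a b c00 c01
  have e2 := hf.2.2.2.2.2 a b c00 c10
  have e3 := hf.2.2.2.2.1 (a+1) b c10 c11
  have e4 := hf.2.2.2.2.2 a (b+1) c01 c11
  have e5 : f (a, b+1) ≠ f (a+1, b) := by
    intro h
    have := hf.2.2.1 _ _ c01 c10 h
    simp at this
  have e6 := le_both hC hf (a+1) (b+1) (m-1) (m-1) (by
    rw [show a+1+(m-1) = a+m by omega, show b+1+(m-1) = b+m by omega]; exact h)
  rw [show a+1+(m-1) = a+m by omega, show b+1+(m-1) = b+m by omega] at e6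
  omega

lemma cnt_eq (hC : IsIdeal C) (hf : IsStdFilling C N f) (i j : ℕ) (hij : i < j) (hj : j < N)
    (h : cnt f i = cnt f j) : i + 3 ≤ j := by
  obtain ⟨c1, v1⟩ := tcell_spec hf (v := i+1) (by omega) (by omega)
  obtain ⟨c2, v2⟩ := tcell_spec hf (v := j+1) (by omega) (by omega)
  unfold cnt at h
  generalize tcell f (i+1) = x at *
  generalize tcell f (j+1) = y at *
  obtain ⟨a, b⟩ := x
  obtain ⟨a', b'⟩ := y
  simp only at *
  rcases lt_trichotomy a a' with h' | h' | h'
  · obtain ⟨m, rfl⟩ : ∃ m, a' = a + m := ⟨a' - a, by omega⟩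
    obtain rfl : b' = b + m := by omega
    have := diag hC hf a b m (by omega) c2
    omega
  · subst h'
    obtain rfl : b = b' := by omega
    omega
  · obtain ⟨m, rfl⟩ : ∃ m, a = a' + m := ⟨a - a', by omega⟩
    obtain rfl : b = b' + m := by omega
    have := diag hC hf a' b' m (by omega) c1
    omega

lemma swap_mem (hf : IsStdFilling C N f) (i : ℕ) (hi : i + 1 < N)
    (hr : ∀ a b, f (a,b) = i+1 → f (a,b+1) ≠ i+2) (hc : ∀ a b, f (a,b) = i+1 → f (a+1,b) ≠ i+2) :
    IsStdFilling C N (sact i f) := by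
  obtain ⟨f1, f2, f3, f4, f5, f6⟩ := hf
  refine ⟨?_, ?_, ?_, ?_, ?_, ?_⟩
  · intro c h
    simp only [sact, f1 c h]
    rw [Equiv.swap_apply_of_ne_of_ne] <;> omega
  · intro c h
    have := f2 c h
    simp only [sact, Equiv.swap_apply_def]
    split_ifs <;> omega
  · intro c c' h h' e
    exact f3 c c' h h' ((Equiv.swap (i+1) (i+2)).injective e)
  · intro v h1 h2
    obtain ⟨c, hc, hv⟩ := f4 (Equiv.swap (i+1) (i+2) v) (by
      simp only [Equiv.swap_apply_def]; split_ifs <;> omega) (by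
      simp only [Equiv.swap_apply_def]; split_ifs <;> omega)
    exact ⟨c, hc, by simp [sact, hv]⟩
  · intro a b h h'
    have := f5 a b h h'
    have := hr a b
    simp only [sact, Equiv.swap_apply_def]
    split_ifs <;> omega
  · intro a b h h'
    have := f6 a b h h'
    have := hc a b
    simp only [sact, Equiv.swap_apply_def]
    split_ifs <;> omega

lemma adj_row (hf : IsStdFilling C N f) (i a b : ℕ) (h1 : f (a,b) = i+1) (h2 : f (a,b+1) = i+2) :
    cnt f (i+1) - cnt f i = 1 := by
  unfold cnt
  rw [tcell_eq hf h1 (by omega), tcell_eq hf h2 (by omega)]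
  push_cast; ring

lemma adj_col (hf : IsStdFilling C N f) (i a b : ℕ) (h1 : f (a,b) = i+1) (h2 : f (a+1,b) = i+2) :
    cnt f (i+1) - cnt f i = -1 := by
  unfold cnt
  rw [tcell_eq hf h1 (by omega), tcell_eq hf h2 (by omega)]
  push_cast; ring

lemma good (hC : IsIdeal C) : GoodSet (SF C N) N where
  ne1 f hf i hi h := by
    have := cnt_eq hC hf i (i+1) (by omega) (by omega) h
    omega
  ne2 f hf i hi h := by
    have := cnt_eq hC hf i (i+2) (by omega) (by omega) h
    omega
  sw f hf i hi h := by
    refine swap_mem hf i hi ?_ ?_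
    · intro a b h1 h2
      exact h (by rw [adj_row hf i a b h1 h2]; rfl)
    · intro a b h1 h2
      exact h (by rw [adj_col hf i a b h1 h2]; rfl)

lemma fin (hfin : {c | C c}.Finite) : (SF C N).Finite := by
  have h1 : ({g : {c | C c} → ℕ | ∀ c, g c ∈ Set.Iic N}).Finite :=
    haveI := hfin.to_subtype
    Set.Finite.pi' (fun _ => Set.finite_Iic N)
  refine Set.Finite.of_finite_image (f := fun f : Fil => fun c : {c | C c} => f c.1) (h1.subset ?_) ?_
  · rintro _ ⟨f, hf, rfl⟩ c
    exact (hf.2.1 c.1 c.2).2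
  · intro f hf g hg h
    funext c
    by_cases hc : C c
    · exact congrFun h ⟨c, hc⟩
    · rw [hf.1 c hc, hg.1 c hc]

end SFl

/-! ### Rectangles -/

/-- cells of the rectangle -/
def RC (b n : ℕ) : ℕ × ℕ → Prop := strCell (rectShape b n)

lemma RC_iff (b n : ℕ) (c : ℕ × ℕ) : RC b n c ↔ c.1 < b ∧ c.2 < n := by
  unfold RC strCell rectShape
  by_cases h : c.1 < b
  · simp [List.getD, h]
  · simp [List.getD, h]

lemma RC_ideal (b n : ℕ) : IsIdeal (RC b n) where
  up a c h := by rw [RC_iff] at *; simp only at *; omega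
  left a c h := by rw [RC_iff] at *; simp only at *; omega

lemma RC_finite (b n : ℕ) : {c | RC b n c}.Finite := by
  apply (Finset.range b ×ˢ Finset.range n).finite_toSet.subset
  intro c hc
  have := (RC_iff b n c).1 hc
  simp [this]

section
variable {b n : ℕ} {f : Fil}

lemma rect_first (hN : 0 < b * n) (hf : IsStdFilling (RC b n) (b*n) f) : f (0,0) = 1 := by
  obtain ⟨c1, v1⟩ := SFl.tcell_spec hf (v := 1) (by omega) (by omega)
  set c := tcell f 1
  have c1' := c1
  rw [RC_iff] at c1'
  have := SFl.le_both (RC_ideal b n) hf 0 0 c.1 c.2 (by simpa using c1)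
  simp only [zero_add] at this
  have c0 : RC b n (0,0) := by rw [RC_iff]; simp only; omega
  have := (hf.2.1 _ c0).1
  rw [show (c.1, c.2) = c from rfl] at *
  omega

lemma rect_last (hN : 0 < b * n) (hf : IsStdFilling (RC b n) (b*n) f) : f (b-1,n-1) = b*n := by
  obtain ⟨c1, v1⟩ := SFl.tcell_spec hf (v := b*n) (by omega) (by omega)
  set c := tcell f (b*n)
  have c1' := c1
  rw [RC_iff] at c1'
  have c0 : RC b n (b-1,n-1) := by rw [RC_iff]; simp only; omega
  have := SFl.le_both (RC_ideal b n) hf c.1 c.2 (b-1-c.1) (n-1-c.2) (by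
    rw [show c.1 + (b-1-c.1) = b-1 by omega, show c.2 + (n-1-c.2) = n-1 by omega]; exact c0)
  rw [show c.1 + (b-1-c.1) = b-1 by omega, show c.2 + (n-1-c.2) = n-1 by omega] at this
  have := (hf.2.1 _ c0).2
  rw [show (c.1, c.2) = c from rfl] at *
  omega

lemma rect_cnt0 (hN : 0 < b * n) (hf : IsStdFilling (RC b n) (b*n) f) : cnt f 0 = 0 := by
  unfold cnt
  rw [SFl.tcell_eq hf (v := 0+1) (rect_first hN hf) (by omega)]; simp

lemma rect_cnt_last (hN : 0 < b * n) (hf : IsStdFilling (RC b n) (b*n) f) :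
    cnt f (b*n-1) = (n:ℤ) - b := by
  unfold cnt
  rw [show b*n-1+1 = b*n by omega, SFl.tcell_eq hf (rect_last hN hf) (by omega)]
  have h1 : 0 < b := Nat.pos_of_mul_pos_right hN
  have h2 : 0 < n := Nat.pos_of_mul_pos_left hN
  simp only
  omega

lemma sum_cnt (hf : IsStdFilling (RC b n) (b*n) f) (F : ℤ → ℤ) :
    ∑ i ∈ Finset.range (b*n), F (cnt f i) = ∑ c ∈ Finset.range b ×ˢ Finset.range n, F ((c.2:ℤ) - c.1) := by
  apply Finset.sum_bij (fun i _ => tcell f (i+1))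
  · intro i hi
    rw [Finset.mem_range] at hi
    obtain ⟨c1, v1⟩ := SFl.tcell_spec hf (v := i+1) (by omega) (by omega)
    rw [RC_iff] at c1
    simp [c1]
  · intro i hi j hj h
    rw [Finset.mem_range] at hi hj
    have h1 := (SFl.tcell_spec hf (v := i+1) (by omega) (by omega)).2
    have h2 := (SFl.tcell_spec hf (v := j+1) (by omega) (by omega)).2
    rw [h] at h1
    omega
  · intro c hc
    have hc' : RC b n c := by rw [RC_iff]; simpa using hc
    have := hf.2.1 c hc'
    refine ⟨f c - 1, by rw [Finset.mem_range]; omega, ?_⟩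
    exact SFl.tcell_eq hf (by omega) (by omega)
  · intro i _
    rfl

lemma rect_sum (hf : IsStdFilling (RC b n) (b*n) f) :
    2 * ∑ i ∈ Finset.range (b*n), cnt f i = ((b*n : ℕ) : ℤ) * ((n:ℤ) - b) := by
  rw [sum_cnt hf (fun x => x), Finset.sum_product]
  simp only [Finset.sum_sub_distrib, Finset.sum_const, Finset.card_range]
  have g : ∀ n : ℕ, 2 * ∑ i ∈ Finset.range n, (i:ℤ) = n * (n - 1) := by
    intro n
    induction n with
    | zero => simp
    | succ n ih => rw [Finset.sum_range_succ, mul_add, ih]; push_cast; ring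
  simp only [nsmul_eq_mul]
  rw [← Finset.mul_sum, mul_sub]
  have g1 := g n
  have g2 := g b
  push_cast
  linear_combination b * g1 - n * g2

end


/-! ### The specialisation `q = 0`: promotion -/

open Classical in
/-- Bender-Knuth involutions -/
noncomputable def bk (i : ℕ) (f : Fil) : Fil := if |cnt f (i+1) - cnt f i| = 1 then f else sact i f

open Classical in
/-- sign attached to the Bender-Knuth involutions -/
noncomputable def bke (i : ℕ) (f : Fil) : ℝ :=
  if |cnt f (i+1) - cnt f i| = 1 then ((cnt f (i+1) - cnt f i : ℤ) : ℝ) else 1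

/-- iterated Bender-Knuth involutions -/
noncomputable def bkS : ℕ → ℕ → Fil → Fil
  | _, 0, f => f
  | a, len+1, f => bkS (a+1) len (bk a f)

/-- iterated signs -/
noncomputable def bkE : ℕ → ℕ → Fil → ℝ
  | _, 0, _ => 1
  | a, len+1, f => bke a f * bkE (a+1) len (bk a f)

lemma abF_zero (i : ℕ) (v : Fil → ℝ) (f : Fil) : abF (Rq 0) (Bq 0) i v f = bke i f * v (bk i f) := by
  unfold abF opF bke bk
  split_ifs with h <;> beta_reduce
  · rw [Bq_one 0 _ _ h, Rq, rq_abs_one 0 _ h]; ring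
  · unfold Rq Bq; rw [rq_zero _ h]; simp

lemma bk_mem {X : Set Fil} {N : ℕ} (hX : GoodSet X N) (i : ℕ) (hi : i + 1 < N) (f : Fil) (hf : f ∈ X) :
    bk i f ∈ X := by
  unfold bk
  split_ifs with h
  · exact hf
  · exact hX.sw f hf i hi h

lemma bkS_mem {X : Set Fil} {N : ℕ} (hX : GoodSet X N) (a len : ℕ) (hi : a + len < N) (f : Fil) (hf : f ∈ X) :
    bkS a len f ∈ X := by
  induction len generalizing a f with
  | zero => exact hf
  | succ l ih => exact ih (a+1) (by omega) _ (bk_mem hX a (by omega) f hf)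

lemma ascP_zero_mulVec {X : Set Fil} [Fintype X] [DecidableEq X] {N : ℕ} (hX : GoodSet X N) (a len : ℕ) (hi : a + len < N)
    (v : Fil → ℝ) :
    (ascP (Rm X 0) a len).mulVec (fun f => v f.1) = fun f => bkE a len f.1 * v (bkS a len f.1) := by
  induction len generalizing a with
  | zero => simp [ascP, bkE, bkS]
  | succ l ih =>
    rw [ascP, ← Matrix.mulVec_mulVec, ih (a+1) (by omega), Rm]
    have := abM_mulVec hX (A := Rq 0) (B := Bq 0) (Bq_one 0) a (by omega) (fun f => bkE (a+1) l f * v (bkS (a+1) l f))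
    rw [this]
    funext f
    rw [abF_zero]
    simp only [bkE, bkS]; ring

namespace SFl
variable {C : ℕ × ℕ → Prop} {N : ℕ} {f : Fil}

lemma adj_cases (hC : IsIdeal C) (hf : IsStdFilling C N f) (i : ℕ) (hi : i + 1 < N) (a b : ℕ) (hx : f (a,b) = i+1) :
    (f (a,b+1) = i+2 ∧ cnt f (i+1) - cnt f i = 1) ∨ (f (a+1,b) = i+2 ∧ cnt f (i+1) - cnt f i = -1) ∨
    |cnt f (i+1) - cnt f i| ≠ 1 := by
  by_cases h : |cnt f (i+1) - cnt f i| = 1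
  swap
  · right; right; exact h
  have hd := h
  obtain ⟨c2, v2⟩ := tcell_spec hf (v := i+2) (by omega) (by omega)
  have c1 : C (a,b) := cell_of_pos hf (by omega)
  have h := (abs_eq zero_le_one).1 h
  unfold cnt at h ⊢
  rw [tcell_eq hf hx (by omega)] at h ⊢
  rw [show i + 1 + 1 = i + 2 from rfl] at *
  generalize tcell f (i+2) = y at *
  obtain ⟨a', b'⟩ := y
  simp only at *
  rcases h with h | h
  · left
    rcases lt_trichotomy a a' with h' | h' | h'
    · obtain ⟨m, rfl⟩ : ∃ m, a' = a + m := ⟨a' - a, by omega⟩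
      obtain rfl : b' = b + (m+1) := by omega
      have := le_both hC hf a b m (m+1) c2
      omega
    · subst h'
      obtain rfl : b' = b + 1 := by omega
      exact ⟨v2, h⟩
    · obtain ⟨m, rfl⟩ : ∃ m, a = a' + (m+1) := ⟨a - a' - 1, by omega⟩
      obtain rfl : b = b' + m := by omega
      have := le_both hC hf a' b' (m+1) m c1
      omega
  · right; left
    rcases lt_trichotomy b b' with h' | h' | h'
    · obtain ⟨m, rfl⟩ : ∃ m, b' = b + m := ⟨b' - b, by omega⟩
      obtain rfl : a' = a + (m+1) := by omega
      have := le_both hC hf a b (m+1) m c2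
      omega
    · subst h'
      obtain rfl : a' = a + 1 := by omega
      exact ⟨v2, h⟩
    · obtain ⟨m, rfl⟩ : ∃ m, b = b' + (m+1) := ⟨b - b' - 1, by omega⟩
      obtain rfl : a = a' + m := by omega
      have := le_both hC hf a' b' m (m+1) c1
      omega

end SFl

/-- the intermediate jeu de taquin filling -/
def jD (j : ℕ) (g : Fil) : Fil := fun c => if g c ≤ j then g c else if g c = j + 1 then 0 else g c - 1

section
variable {b n : ℕ}

lemma promote_aux (hN : 0 < b * n) (m : ℕ) : ∀ (j : ℕ), j + m + 1 = b * n → ∀ g, IsStdFilling (RC b n) (b*n) g →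
    ∀ r c, g (r,c) = j+1 → ∀ fuel, m ≤ fuel →
    bkS j m g = Function.update (jdtSlide fuel (jD j g) (r,c)).1 (jdtSlide fuel (jD j g) (r,c)).2 (b*n) ∧
    bkE j m g = (-1)^(b-1-r) := by
  induction m with
  | zero =>
    intro j hj g hg r c hx fuel _
    have hl := rect_last hN hg
    have hxc : (r,c) = (b-1,n-1) := by
      have c1 : RC b n (r,c) := SFl.cell_of_pos hg (by omega)
      have c0 : RC b n (b-1,n-1) := SFl.cell_of_pos hg (by omega)
      exact hg.2.2.1 _ _ c1 c0 (by omega)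
    obtain ⟨rfl, rfl⟩ := Prod.mk.inj hxc
    have hb : 0 < b := Nat.pos_of_mul_pos_right hN
    have hn : 0 < n := Nat.pos_of_mul_pos_left hN
    have z1 : g (b-1, n-1+1) = 0 := hg.1 _ (by rw [RC_iff]; simp only; omega)
    have z2 : g (b-1+1, n-1) = 0 := hg.1 _ (by rw [RC_iff]; simp only; omega)
    have hs : jdtSlide fuel (jD j g) (b-1,n-1) = (jD j g, (b-1,n-1)) := by
      cases fuel with
      | zero => rfl
      | succ k => simp [jdtSlide, jD, z1, z2]
    rw [hs]
    refine ⟨?_, by simp [bkE]⟩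
    funext y
    simp only [bkS]
    by_cases hy : y = (b-1,n-1)
    · subst hy; simp [hl]
    · rw [Function.update_of_ne hy]
      have : g y ≠ b * n := by
        intro h
        apply hy
        have c1 : RC b n y := SFl.cell_of_pos hg (by omega)
        have c0 : RC b n (b-1,n-1) := SFl.cell_of_pos hg (by omega)
        exact hg.2.2.1 _ _ c1 c0 (by omega)
      have h2 : g y ≤ b * n := by
        by_cases hc : RC b n y
        · exact (hg.2.1 y hc).2
        · rw [hg.1 y hc]; omega
      simp only [jD]
      rw [if_pos (by omega)]
  | succ m ih =>
    intro j hj g hg r c hx fuel hfuel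
    have hC := RC_ideal b n
    have cx : RC b n (r,c) := SFl.cell_of_pos hg (by omega)
    have inj : ∀ y, g y ≠ 0 → ∀ y', g y = g y' → y = y' := by
      intro y h y' h'
      exact hg.2.2.1 _ _ (SFl.cell_of_pos hg h) (SFl.cell_of_pos hg (by omega)) h'
    have gr : g (r,c+1) ≠ 0 → j + 2 ≤ g (r,c+1) := by
      intro h
      have := hg.2.2.2.2.1 r c cx (SFl.cell_of_pos hg h)
      omega
    have gd : g (r+1,c) ≠ 0 → j + 2 ≤ g (r+1,c) := by
      intro h
      have := hg.2.2.2.2.2 r c cx (SFl.cell_of_pos hg h)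
      omega
    have gne : g (r,c+1) ≠ 0 → g (r,c+1) ≠ g (r+1,c) := by
      intro h h'
      have := inj _ h _ h'
      simp at this
    obtain ⟨fuel, rfl⟩ : ∃ k, fuel = k + 1 := ⟨fuel - 1, by omega⟩
    rcases SFl.adj_cases hC hg j (by omega) r c hx with ⟨h, e⟩ | ⟨h, e⟩ | h
    · have hb1 : bk j g = g := by unfold bk; rw [if_pos (by rw [e]; rfl)]
      have hb2 : bke j g = 1 := by unfold bke; rw [if_pos (by rw [e]; rfl), e]; simp
      have hstep : jdtSlide (fuel+1) (jD j g) (r,c) = jdtSlide fuel (jD (j+1) g) (r,c+1) := by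
        rw [jdtSlide]
        have v1 : jD j g (r,c+1) = j+1 := by simp only [jD, h]; split_ifs <;> omega
        have v2 : jD j g (r+1,c) = 0 ∨ j + 1 < jD j g (r+1,c) := by
          simp only [jD]
          by_cases h0 : g (r+1,c) = 0
          · left; simp [h0]
          · right
            have := gd h0
            have := gne (by omega)
            split_ifs <;> omega
        simp only
        rw [if_neg (by omega), if_pos (by omega)]
        congr 1
        funext y
        by_cases y1 : y = (r,c)
        · subst y1; rw [Function.update_self, v1]; simp [jD, hx]
        · rw [Function.update_of_ne y1]
          by_cases y2 : y = (r,c+1)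
          · subst y2; simp only [Function.update_self, jD, h]; simp
          · rw [Function.update_of_ne y2]
            have n1 : g y ≠ j+1 := fun hh => y1 (inj _ (by omega) _ (by omega))
            have n2 : g y ≠ j+2 := fun hh => y2 (inj _ (by omega) _ (by omega))
            simp only [jD]
            split_ifs <;> omega
      obtain ⟨i1, i2⟩ := ih (j+1) (by omega) g hg r (c+1) h fuel (by omega)
      rw [hstep, bkS, bkE, hb1, hb2, i2]
      exact ⟨i1, by simp⟩
    · have hb1 : bk j g = g := by unfold bk; rw [if_pos (by rw [e]; rfl)]
      have hb2 : bke j g = -1 := by unfold bke; rw [if_pos (by rw [e]; rfl), e]; simp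
      have hstep : jdtSlide (fuel+1) (jD j g) (r,c) = jdtSlide fuel (jD (j+1) g) (r+1,c) := by
        rw [jdtSlide]
        have v1 : jD j g (r+1,c) = j+1 := by simp only [jD, h]; split_ifs <;> omega
        have v2 : jD j g (r,c+1) = 0 ∨ j + 1 < jD j g (r,c+1) := by
          simp only [jD]
          by_cases h0 : g (r,c+1) = 0
          · left; simp [h0]
          · right
            have := gr h0
            have := gne (by omega)
            split_ifs <;> omega
        simp only
        rw [if_neg (by omega), if_neg (by omega)]
        congr 1
        funext y
        by_cases y1 : y = (r,c)
        · subst y1; rw [Function.update_self, v1]; simp [jD, hx]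
        · rw [Function.update_of_ne y1]
          by_cases y2 : y = (r+1,c)
          · subst y2; simp only [Function.update_self, jD, h]; simp
          · rw [Function.update_of_ne y2]
            have n1 : g y ≠ j+1 := fun hh => y1 (inj _ (by omega) _ (by omega))
            have n2 : g y ≠ j+2 := fun hh => y2 (inj _ (by omega) _ (by omega))
            simp only [jD]
            split_ifs <;> omega
      obtain ⟨i1, i2⟩ := ih (j+1) (by omega) g hg (r+1) c h fuel (by omega)
      rw [hstep, bkS, bkE, hb1, hb2, i2]
      refine ⟨i1, ?_⟩
      have : RC b n (r+1,c) := SFl.cell_of_pos hg (by omega)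
      rw [RC_iff] at this
      simp only at this
      rw [show b - 1 - r = b - 1 - (r+1) + 1 by omega, pow_succ]; ring
    · have hb1 : bk j g = sact j g := by unfold bk; rw [if_neg h]
      have hb2 : bke j g = 1 := by unfold bke; rw [if_neg h]
      have hg' : IsStdFilling (RC b n) (b*n) (sact j g) := (SFl.good hC).sw g hg j (by omega) h
      have hD : jD (j+1) (sact j g) = jD j g := by
        funext y
        simp only [jD, sact, Equiv.swap_apply_def]
        split_ifs <;> omega
      obtain ⟨i1, i2⟩ := ih (j+1) (by omega) (sact j g) hg' r c (by simp [sact, hx]) (fuel+1) (by omega)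
      rw [bkS, bkE, hb1, hb2, i2]
      rw [hD] at i1
      exact ⟨i1, by simp⟩

lemma promote_bk (hN : 0 < b * n) (g : Fil) (hg : IsStdFilling (RC b n) (b*n) g) :
    bkS 0 (b*n-1) g = promote (b*n) g ∧ bkE 0 (b*n-1) g = (-1)^(b-1) := by
  have := promote_aux hN (b*n-1) 0 (by omega) g hg 0 0 (rect_first hN hg) (b*n) (by omega)
  have hD : jD 0 g = fun c => g c - 1 := by
    funext y
    simp only [jD]
    split_ifs <;> omega
  rw [hD] at this
  exact this

lemma promote_mem (hN : 0 < b * n) (g : Fil) (hg : g ∈ SF (RC b n) (b*n)) : promote (b*n) g ∈ SF (RC b n) (b*n) := by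
  rw [← (promote_bk hN g hg).1]
  exact bkS_mem (SFl.good (RC_ideal b n)) 0 _ (by omega) g hg

lemma Pm_zero_pow [Fintype (SF (RC b n) (b*n))] [DecidableEq (SF (RC b n) (b*n))] (hN : 0 < b * n) (d : ℕ) (v : Fil → ℝ) :
    ((Pm (SF (RC b n) (b*n)) (b*n) 0)^d).mulVec (fun f => v f.1)
      = fun f => ((-1)^(b-1))^d * v ((promote (b*n))^[d] f.1) := by
  induction d generalizing v with
  | zero => simp
  | succ d ih =>
    rw [pow_succ, ← Matrix.mulVec_mulVec, Pm, ascP_zero_mulVec (SFl.good (RC_ideal b n)) 0 _ (by omega)]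
    have e : (fun f : SF (RC b n) (b*n) => bkE 0 (b*n-1) f.1 * v (bkS 0 (b*n-1) f.1)) =
        fun f => (fun f : Fil => (-1)^(b-1) * v (promote (b*n) f)) f.1 := by
      funext f
      rw [(promote_bk hN f.1 f.2).1, (promote_bk hN f.1 f.2).2]
    rw [e]
    have := ih (fun f : Fil => (-1)^(b-1) * v (promote (b*n) f))
    rw [Pm] at this
    rw [this]
    funext f
    simp only [Function.iterate_succ', Function.comp_apply]
    ring

lemma Pm_zero_trace [Fintype (SF (RC b n) (b*n))] [DecidableEq (SF (RC b n) (b*n))] (hN : 0 < b * n) (d : ℕ) :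
    ((Pm (SF (RC b n) (b*n)) (b*n) 0)^d).trace =
      ((-1)^(b-1))^d * (({f | IsStdFilling (RC b n) (b*n) f ∧ (promote (b*n))^[d] f = f}).ncard : ℝ) := by
  classical
  have hdiag : ∀ f : SF (RC b n) (b*n), ((Pm (SF (RC b n) (b*n)) (b*n) 0)^d) f f =
      ((-1)^(b-1))^d * (if (promote (b*n))^[d] f.1 = f.1 then 1 else 0) := by
    intro f
    have := congrFun (Pm_zero_pow hN d (fun g => if g = f.1 then 1 else 0)) f
    rw [← this]
    have e : (fun g : SF (RC b n) (b*n) => if g.1 = f.1 then (1:ℝ) else 0) = Pi.single f 1 := by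
      funext g
      simp [Pi.single_apply, Subtype.ext_iff]
    rw [e]
    simp
  rw [Matrix.trace]
  simp only [Matrix.diag_apply, hdiag]
  rw [← Finset.mul_sum]
  congr 1
  rw [Finset.sum_boole]
  have e2 : {f | IsStdFilling (RC b n) (b*n) f ∧ (promote (b*n))^[d] f = f} =
      (fun f : SF (RC b n) (b*n) => f.1) '' {f | (promote (b*n))^[d] f.1 = f.1} := by
    ext f
    constructor
    · rintro ⟨h1, h2⟩
      exact ⟨⟨f, h1⟩, h2, rfl⟩
    · rintro ⟨g, hg, rfl⟩
      exact ⟨g.2, hg⟩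
  rw [e2, Set.ncard_image_of_injective _ Subtype.val_injective, ← Set.ncard_coe_finset]
  congr 2
  ext f
  simp

/-- The main consequence of the deformation argument. -/
lemma fix_trace [Fintype (SF (RC b n) (b*n))] [DecidableEq (SF (RC b n) (b*n))] (hN : 0 < b * n) (d : ℕ) :
    ((-1)^(b-1))^d * (({f | IsStdFilling (RC b n) (b*n) f ∧ (promote (b*n))^[d] f = f}).ncard : ℝ) =
    ((Pm (SF (RC b n) (b*n)) (b*n) 1)^d).trace := by
  rw [← Pm_zero_trace hN d]
  exact (trace_const (Pm (SF (RC b n) (b*n)) (b*n)) Pm_continuous (b*n) hN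
    (fun q h0 h1 => Pm_pow (SFl.good (RC_ideal b n)) hN ((n:ℤ)-b) (fun f hf => rect_cnt0 hN hf)
      (fun f hf => rect_cnt_last hN hf) (fun f hf => rect_sum hf) q h0 h1) d).1

lemma promote_order (hN : 0 < b * n) (f : Fil) (hf : f ∈ SF (RC b n) (b*n)) : (promote (b*n))^[b*n] f = f := by
  classical
  haveI := (SFl.fin (N := b*n) (RC_finite b n)).fintype
  have h1 := (trace_const (Pm (SF (RC b n) (b*n)) (b*n)) Pm_continuous (b*n) hN
    (fun q h0 h1 => Pm_pow (SFl.good (RC_ideal b n)) hN ((n:ℤ)-b) (fun f hf => rect_cnt0 hN hf)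
      (fun f hf => rect_cnt_last hN hf) (fun f hf => rect_sum hf) q h0 h1) 0).2
  have := congrFun (Pm_zero_pow hN (b*n) (fun g => if g = f then 1 else 0)) ⟨f, hf⟩
  rw [h1] at this
  simp only [Matrix.one_mulVec, if_true] at this
  by_contra hne
  rw [if_neg hne] at this
  simp at this

end


/-! ### The specialisation `q = 1`: conjugacy in the symmetric group -/

/-- skip every `k`-th generator -/
def skp {M : Type*} [One M] (k : ℕ) (s : ℕ → M) : ℕ → M := fun i => if k ∣ i + 1 then 1 else s i

/-- adjacent transpositions -/
def adjT (i : ℕ) : Equiv.Perm ℕ := Equiv.swap i (i+1)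

lemma block_apply (k : ℕ) (len : ℕ) (x : ℕ) :
    ascP (skp k adjT) 0 len x = if x ≤ len then (if k ∣ x + 1 ∨ x = len then k * (x / k) else x + 1) else x := by
  induction len generalizing x with
  | zero =>
    simp only [ascP, Equiv.Perm.coe_one, id]
    split_ifs with h1 h2
    · obtain rfl : x = 0 := by omega
      simp
    · omega
    · rfl
  | succ l ih =>
    rw [ascP_succ_right, zero_add, Equiv.Perm.mul_apply]
    by_cases hd : k ∣ l + 1
    · rw [skp, if_pos hd, Equiv.Perm.coe_one, id, ih]
      by_cases hx : x = l + 1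
      · subst hx
        rw [if_neg (by omega), if_pos le_rfl, if_pos (Or.inr rfl), Nat.mul_div_cancel' hd]
      · by_cases hx' : x = l
        · subst hx'
          simp [hd]
        · have e1 : (x ≤ l) = (x ≤ l+1) := by apply propext; omega
          simp [e1, hx, hx']
    · rw [skp, if_neg hd, adjT]
      by_cases hx : x = l + 1
      · subst hx
        rw [Equiv.swap_apply_right, ih]
        have : (l + 1) / k = l / k := Nat.succ_div_of_not_dvd hd
        simp [this]
      · by_cases hx' : x = l
        · subst hx'
          rw [Equiv.swap_apply_left, ih]
          simp [hd]
        · rw [Equiv.swap_apply_of_ne_of_ne hx' hx, ih]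
          have e1 : (x ≤ l) = (x ≤ l+1) := by apply propext; omega
          simp [e1, hx, hx']

lemma ascP_congr {M : Type*} [Monoid M] (s t : ℕ → M) (a len : ℕ) (h : ∀ i, a ≤ i → i < a + len → s i = t i) :
    ascP s a len = ascP t a len := by
  induction len generalizing a with
  | zero => rfl
  | succ l ih => rw [ascP, ascP, h a le_rfl (by omega), ih (a+1) (fun i h1 h2 => h i (by omega) (by omega))]

lemma ascP_map {M M' : Type*} [Monoid M] [Monoid M'] (φ : M →* M') (s : ℕ → M) (a len : ℕ) :
    φ (ascP s a len) = ascP (fun i => φ (s i)) a len := by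
  induction len generalizing a with
  | zero => simp [ascP]
  | succ l ih => rw [ascP, ascP, map_mul, ih]

lemma ascP_mem {H : Type*} [Group H] (K : Subgroup H) (s : ℕ → H) (a len : ℕ)
    (h : ∀ i, a ≤ i → i < a + len → s i ∈ K) : ascP s a len ∈ K := by
  induction len generalizing a with
  | zero => exact K.one_mem
  | succ l ih => exact K.mul_mem (h a le_rfl (by omega)) (ih (a+1) (fun i h1 h2 => h i (by omega) (by omega)))

lemma cyc_apply (N : ℕ) (hN : 0 < N) (x : ℕ) :
    ascP adjT 0 (N-1) x = if x < N then (x + 1) % N else x := by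
  have e : ascP adjT 0 (N-1) = ascP (skp N adjT) 0 (N-1) := by
    apply ascP_congr
    intro i _ hi
    rw [skp, if_neg]
    intro h
    have := Nat.le_of_dvd (by omega) h
    omega
  rw [e, block_apply N]
  by_cases hx : x < N
  · rw [if_pos (by omega), if_pos hx]
    by_cases h : x + 1 = N
    · rw [if_pos (Or.inr (by omega)), h, Nat.mod_self, Nat.div_eq_of_lt hx, mul_zero]
    · rw [if_neg, Nat.mod_eq_of_lt (by omega)]
      rintro (h' | h')
      · have := Nat.le_of_dvd (by omega) h'
        omega
      · omega
  · rw [if_neg (by omega), if_neg hx]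

lemma cyc_pow_apply (N : ℕ) (hN : 0 < N) (d x : ℕ) :
    ((ascP adjT 0 (N-1))^d) x = if x < N then (x + d) % N else x := by
  induction d generalizing x with
  | zero =>
    split_ifs with h
    · simp [Nat.mod_eq_of_lt h]
    · rfl
  | succ d ih =>
    rw [pow_succ, Equiv.Perm.mul_apply, cyc_apply N hN, ih]
    by_cases hx : x < N
    · simp only [hx, if_true, Nat.mod_lt _ hN, Nat.mod_add_mod]
      congr 1; ring
    · simp [hx]

/-- the conjugating permutation -/
def conjP (k d : ℕ) (hk : 0 < k) (hd : 0 < d) : Equiv.Perm ℕ where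
  toFun i := if i < k * d then i / k + d * (i % k) else i
  invFun i := if i < k * d then (i % d) * k + i / d else i
  left_inv i := by
    by_cases h : i < k * d
    · have h1 : i / k < d := Nat.div_lt_of_lt_mul h
      have h2 : i % k < k := Nat.mod_lt _ hk
      have h3 : i / k + d * (i % k) < k * d := by
        have : d * (i % k + 1) ≤ d * k := Nat.mul_le_mul_left _ h2
        nlinarith
      simp only [h, if_true, h3]
      rw [Nat.add_mul_mod_self_left, Nat.mod_eq_of_lt h1, Nat.add_mul_div_left _ _ hd, Nat.div_eq_of_lt h1, zero_add]
      exact Nat.div_add_mod' i k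
    · simp [h]
  right_inv i := by
    by_cases h : i < k * d
    · have h1 : i / d < k := Nat.div_lt_of_lt_mul (by rw [mul_comm]; exact h)
      have h2 : i % d < d := Nat.mod_lt _ hd
      have h3 : (i % d) * k + i / d < k * d := by
        have : k * (i % d + 1) ≤ k * d := Nat.mul_le_mul_left _ h2
        nlinarith
      simp only [h, if_true, h3]
      rw [mul_comm (i % d) k, Nat.mul_add_div hk, Nat.div_eq_of_lt h1, Nat.mul_add_mod, Nat.mod_eq_of_lt h1, add_zero]
      exact Nat.mod_add_div i d
    · simp [h]

lemma conjP_comm (k d : ℕ) (hk : 0 < k) (hd : 0 < d) :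
    (ascP adjT 0 (k*d-1))^d * conjP k d hk hd = conjP k d hk hd * ascP (skp k adjT) 0 (k*d-1) := by
  have hN : 0 < k * d := by positivity
  ext x
  have cj : ∀ i, conjP k d hk hd i = if i < k * d then i / k + d * (i % k) else i := fun i => rfl
  rw [Equiv.Perm.mul_apply, Equiv.Perm.mul_apply, cyc_pow_apply _ hN, block_apply k, cj, cj]
  by_cases h : x < k * d
  · have h1 : x / k < d := Nat.div_lt_of_lt_mul h
    have h2 : x % k < k := Nat.mod_lt _ hk
    have h3 : x / k + d * (x % k) < k * d := by
      have : d * (x % k + 1) ≤ d * k := Nat.mul_le_mul_left _ h2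
      nlinarith
    have hor : (k ∣ x + 1 ∨ x = k * d - 1) ↔ k ∣ x + 1 := by
      constructor
      · rintro (h | h)
        · exact h
        · exact ⟨d, by omega⟩
      · exact Or.inl
    rw [if_pos h, if_pos h3, if_pos (show x ≤ k * d - 1 by omega)]
    simp only [hor]
    by_cases hdv : k ∣ x + 1
    · rw [if_pos hdv]
      have e1 : x % k + 1 = k := by
        obtain ⟨c, hc⟩ := hdv
        have := Nat.div_add_mod x k
        by_contra hne
        have h5 : (x + 1) % k = x % k + 1 := by
          rw [Nat.add_mod, Nat.mod_eq_of_lt (show 1 < k by omega), Nat.mod_eq_of_lt (by omega)]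
        rw [hc, Nat.mul_mod_right] at h5
        omega
      have e2 : x / k + d * (x % k) + d = x / k + k * d := by
        calc _ = x / k + d * (x % k + 1) := by ring
          _ = _ := by rw [e1]; ring
      rw [e2, Nat.add_mod_right, Nat.mod_eq_of_lt (by nlinarith), if_pos]
      · rw [Nat.mul_div_cancel_left _ hk, Nat.mul_mod_right]; simp
      · exact (Nat.mul_lt_mul_left hk).2 h1
    · rw [if_neg hdv]
      have e1 : x % k + 1 < k := by
        by_contra hne
        apply hdv
        have := Nat.div_add_mod x k
        exact ⟨x / k + 1, by rw [mul_add]; omega⟩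
      have e2 : x / k + d * (x % k) + d < k * d := by
        have : d * (x % k + 1 + 1) ≤ d * k := Nat.mul_le_mul_left _ e1
        nlinarith
      have e3 : x + 1 < k * d := by
        rcases Nat.lt_or_ge (x+1) (k*d) with h | h
        · exact h
        · exact absurd ⟨d, by omega⟩ hdv
      rw [Nat.mod_eq_of_lt e2, if_pos e3, Nat.succ_div_of_not_dvd hdv, Nat.add_mod,
        Nat.mod_eq_of_lt (show 1 < k by omega), Nat.mod_eq_of_lt e1]
      ring
  · rw [if_neg h, if_neg h, if_neg (show ¬ x ≤ k * d - 1 by omega), if_neg h]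

lemma asc_top (j len x : ℕ) : (x = j + len → ascP adjT j len x = j) ∧ (j + len < x → ascP adjT j len x = x) := by
  induction len generalizing x with
  | zero => simp [ascP]
  | succ l ih =>
    rw [ascP_succ_right, Equiv.Perm.mul_apply, adjT]
    constructor
    · rintro rfl
      rw [show j + (l+1) = j + l + 1 by omega, Equiv.swap_apply_right]
      exact (ih _).1 rfl
    · intro h
      rw [Equiv.swap_apply_of_ne_of_ne (by omega) (by omega)]
      exact (ih _).2 (by omega)

section
variable {H : Type*} [Group H]

lemma lift_perm (s : ℕ → H) (φ : H →* Equiv.Perm ℕ) (hφ : ∀ i, φ (s i) = adjT i) (m : ℕ) :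
    ∀ τ : Equiv.Perm ℕ, (∀ x, m < x → τ x = x) → ∃ h ∈ Subgroup.closure (s '' {i | i < m}), φ h = τ := by
  induction m with
  | zero =>
    intro τ hτ
    refine ⟨1, Subgroup.one_mem _, ?_⟩
    rw [map_one]
    ext x
    by_cases hx : 0 < x
    · rw [hτ x hx]; rfl
    · obtain rfl : x = 0 := by omega
      by_contra h
      have h1 : 0 < τ 0 := by
        simp only [Equiv.Perm.coe_one, id] at h; omega
      have := τ.injective (hτ _ h1)
      omega
  | succ m ih =>
    intro τ hτ
    have hj : τ (m+1) ≤ m + 1 := by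
      by_contra h
      have := τ.injective (hτ (τ (m+1)) (by omega))
      omega
    set j := τ (m+1) with hjdef
    have hφa : φ (ascP s j (m+1-j)) = ascP adjT j (m+1-j) := by
      rw [ascP_map]; congr 1; funext i; exact hφ i
    obtain ⟨h, hh, hφh⟩ := ih ((ascP adjT j (m+1-j))⁻¹ * τ) (by
      intro x hx
      rw [Equiv.Perm.mul_apply, Equiv.Perm.inv_eq_iff_eq]
      by_cases hx' : x = m+1
      · subst hx'
        rw [(asc_top j (m+1-j) (m+1)).1 (by omega)]
      · rw [hτ x (by omega), (asc_top j (m+1-j) x).2 (by omega)])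
    refine ⟨ascP s j (m+1-j) * h, Subgroup.mul_mem _ ?_ ?_, ?_⟩
    · apply ascP_mem
      intro i h1 h2
      exact Subgroup.subset_closure ⟨i, by simp; omega, rfl⟩
    · refine Subgroup.closure_mono ?_ hh
      apply Set.image_mono
      intro i hi; simp at hi ⊢; omega
    · rw [map_mul, hφa, hφh, mul_inv_cancel_left]

lemma cox_conj (s : ℕ → H) (φ : H →* Equiv.Perm ℕ) (hφ : ∀ i, φ (s i) = adjT i) (k d : ℕ) (hk : 0 < k) (hd : 0 < d)
    (h2 : ∀ i, i < k*d-1 → s i * s i = 1)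
    (hb : ∀ i, i + 1 < k*d-1 → s i * s (i+1) * s i = s (i+1) * s i * s (i+1))
    (hc : ∀ i j, i + 2 ≤ j → j < k*d-1 → s i * s j = s j * s i) :
    ∃ h : H, (ascP s 0 (k*d-1))^d * h = h * ascP (skp k s) 0 (k*d-1) := by
  have hN : 0 < k * d := by positivity
  obtain ⟨h, hh, hφh⟩ := lift_perm s φ hφ (k*d-1) (conjP k d hk hd) (by
    intro x hx
    simp only [conjP, Equiv.coe_fn_mk]
    rw [if_neg (by omega)])
  refine ⟨h, ?_⟩
  have m1 : ascP s 0 (k*d-1) ∈ Subgroup.closure (s '' {i | i < k*d-1}) := by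
    apply ascP_mem
    intro i h1 h2
    exact Subgroup.subset_closure ⟨i, by simp; omega, rfl⟩
  have m2 : ascP (skp k s) 0 (k*d-1) ∈ Subgroup.closure (s '' {i | i < k*d-1}) := by
    apply ascP_mem
    intro i h1 h2
    unfold skp
    split_ifs
    · exact Subgroup.one_mem _
    · exact Subgroup.subset_closure ⟨i, by simp; omega, rfl⟩
  have p1 : φ (ascP s 0 (k*d-1)) = ascP adjT 0 (k*d-1) := by
    rw [ascP_map]; congr 1; funext i; exact hφ i
  have p2 : φ (ascP (skp k s) 0 (k*d-1)) = ascP (skp k adjT) 0 (k*d-1) := by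
    rw [ascP_map]; congr 1; funext i
    unfold skp
    split_ifs
    · simp
    · exact hφ i
  have := cox_ker s φ hφ (k*d-1) h2 hb hc (k*d-1) le_rfl
    (((ascP s 0 (k*d-1))^d * h) * (h * ascP (skp k s) 0 (k*d-1))⁻¹)
    (Subgroup.mul_mem _ (Subgroup.mul_mem _ (Subgroup.pow_mem _ m1 _) hh)
      (Subgroup.inv_mem _ (Subgroup.mul_mem _ hh m2)))
    (by rw [map_mul, map_inv, map_mul, map_mul, map_pow, p1, p2, hφh, conjP_comm k d hk hd, mul_inv_cancel])
  exact mul_inv_eq_one.1 this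

end

lemma adjT_sq (i : ℕ) : adjT i * adjT i = 1 := Equiv.swap_mul_self _ _

lemma adjT_braid (i : ℕ) : adjT i * adjT (i+1) * adjT i = adjT (i+1) * adjT i * adjT (i+1) := by
  ext x
  simp only [Equiv.Perm.mul_apply, adjT, Equiv.swap_apply_def]
  split_ifs <;> omega

lemma adjT_comm (i j : ℕ) (h : i + 2 ≤ j) : adjT i * adjT j = adjT j * adjT i := by
  ext x
  simp only [Equiv.Perm.mul_apply, adjT, Equiv.swap_apply_def]
  split_ifs <;> omega

section
variable {X : Set Fil} [Fintype X] [DecidableEq X] {N : ℕ}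

lemma trace_conj (hX : GoodSet X N) (k d : ℕ) (hk : 0 < k) (hd : 0 < d) (hkd : k * d = N) :
    ((Pm X N 1)^d).trace = (ascP (skp k (Rm X 1)) 0 (N-1)).trace := by
  subst hkd
  have sq : ∀ i, i + 1 < k*d → Rm X 1 i * Rm X 1 i = 1 := fun i hi => abM_sq hX ABax_one i hi
  have br : ∀ i, i + 2 < k*d → _ := fun i hi => abM_braid hX ABax_one i hi
  have cm : ∀ i j, i + 2 ≤ j → j + 1 < k*d → _ := fun i j h hi => abM_comm hX (A := Rq 1) ABax_one.b1 i j h hi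
  let U : ℕ → (Matrix X X ℝ)ˣ := fun i => if h : i + 1 < k*d then ⟨Rm X 1 i, Rm X 1 i, sq i h, sq i h⟩ else 1
  have hU : ∀ i, i + 1 < k*d → ((U i : (Matrix X X ℝ)ˣ) : Matrix X X ℝ) = Rm X 1 i := by
    intro i hi; simp only [U, dif_pos hi]
  let s : ℕ → Equiv.Perm ℕ × (Matrix X X ℝ)ˣ := fun i => (adjT i, U i)
  obtain ⟨h, hh⟩ := cox_conj s (MonoidHom.fst _ _) (fun i => rfl) k d hk hd
    (by
      intro i hi
      refine Prod.ext (adjT_sq i) (Units.ext ?_)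
      simp only [s, Prod.snd_mul, Units.val_mul, Prod.snd_one, Units.val_one]
      rw [hU i (by omega)]; exact sq i (by omega))
    (by
      intro i hi
      refine Prod.ext (adjT_braid i) (Units.ext ?_)
      simp only [s, Prod.snd_mul, Units.val_mul]
      rw [hU i (by omega), hU (i+1) (by omega)]; exact br i (by omega))
    (by
      intro i j hij hj
      refine Prod.ext (adjT_comm i j hij) (Units.ext ?_)
      simp only [s, Prod.snd_mul, Units.val_mul]
      rw [hU i (by omega), hU j (by omega)]; exact cm i j hij (by omega))
  let ψ : Equiv.Perm ℕ × (Matrix X X ℝ)ˣ →* Matrix X X ℝ := (Units.coeHom _).comp (MonoidHom.snd _ _)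
  have e := congrArg ψ hh
  rw [map_mul, map_mul, map_pow, ascP_map, ascP_map] at e
  have e1 : ascP (fun i => ψ (s i)) 0 (k*d-1) = Pm X (k*d) 1 := by
    apply ascP_congr
    intro i _ hi
    exact hU i (by omega)
  have e2 : ascP (fun i => ψ (skp k s i)) 0 (k*d-1) = ascP (skp k (Rm X 1)) 0 (k*d-1) := by
    apply ascP_congr
    intro i _ hi
    unfold skp
    split_ifs
    · simp
    · exact hU i (by omega)
  rw [e1, e2] at e
  have e3 : ψ h = ((h.2 : (Matrix X X ℝ)ˣ) : Matrix X X ℝ) := rfl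
  rw [e3] at e
  have e4 : (Pm X (k*d) 1)^d = (h.2 : Matrix X X ℝ) * ascP (skp k (Rm X 1)) 0 (k*d-1) * ((h.2⁻¹ : (Matrix X X ℝ)ˣ) : Matrix X X ℝ) := by
    rw [← e, mul_assoc, Units.mul_inv, mul_one]
  rw [e4, Matrix.trace_units_conj]

end

/-! ### The trace of a product of distinct ascending generators -/

section
variable {C : ℕ × ℕ → Prop} {N : ℕ} [Fintype (SF C N)] [DecidableEq (SF C N)]

/-- matrices preserving the position of the value `a` -/
def Pres (X : Set Fil) (a : ℕ) (M : Matrix X X ℝ) : Prop :=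
  ∀ g h, M g h ≠ 0 → ∀ c, g.1 c = a ↔ h.1 c = a

lemma pres_asc (k a : ℕ) (b len : ℕ) (hab : a ≤ b) :
    Pres (SF C N) a (ascP (skp k (Rm (SF C N) 1)) b len) := by
  induction len generalizing b with
  | zero =>
    intro g h hne c
    simp only [ascP, Matrix.one_apply] at hne
    have : g = h := by by_contra hh; simp [hh] at hne
    rw [this]
  | succ l ih =>
    intro g h hne c
    rw [ascP, Matrix.mul_apply] at hne
    obtain ⟨m, _, hm⟩ := Finset.exists_ne_zero_of_sum_ne_zero hne
    have h1 := left_ne_zero_of_mul hm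
    have h2 := ih (b+1) (by omega) m h (right_ne_zero_of_mul hm) c
    rw [← h2]
    unfold skp at h1
    split_ifs at h1 with hk
    · have : g = m := by by_contra hh; simp [hh] at h1
      rw [this]
    · simp only [Rm, abM, opM, Matrix.of_apply] at h1
      by_cases e1 : m = g
      · rw [e1]
      · by_cases e2 : m.1 = sact b g.1
        · rw [e2, sact, Equiv.swap_apply_def]
          split_ifs <;> omega
        · simp [e1, e2] at h1

lemma diag_asc (k : ℕ) (a len : ℕ) (h : a + len < N) (f : SF C N) :
    ascP (skp k (Rm (SF C N) 1)) a len f f =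
      ∏ i ∈ Finset.range len, (if k ∣ a + i + 1 then 1 else Rq 1 (cnt f.1 (a+i)) (cnt f.1 (a+i+1))) := by
  induction len generalizing a with
  | zero => simp [ascP]
  | succ l ih =>
    rw [ascP, Matrix.mul_apply, Finset.sum_eq_single f, ih (a+1) (by omega), Finset.prod_range_succ', mul_comm]
    · congr 1
      · apply Finset.prod_congr rfl
        intro i _
        rw [show a + 1 + i = a + (i+1) by omega]
      · rw [add_zero]
        unfold skp
        split_ifs
        · simp
        · obtain ⟨c, v⟩ := SFl.tcell_spec f.2 (v := a+1) (by omega) (by omega)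
          have : f.1 ≠ sact a f.1 := by
            intro hh
            have := congrFun hh (tcell f.1 (a+1))
            rw [sact, v, Equiv.swap_apply_left] at this
            omega
          simp [Rm, abM, opM, this]
    · intro g _ hg
      by_contra hne
      have h1 := left_ne_zero_of_mul hne
      have h2 := pres_asc k (a+1) (a+1) l le_rfl g f (right_ne_zero_of_mul hne)
      unfold skp at h1
      split_ifs at h1 with hk
      · exact h1 (by simp [Ne.symm hg])
      · simp only [Rm, abM, opM, Matrix.of_apply] at h1
        by_cases e2 : g.1 = sact a f.1
        · obtain ⟨c, v⟩ := SFl.tcell_spec f.2 (v := a+2) (by omega) (by omega)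
          have := h2 (tcell f.1 (a+2))
          rw [e2, sact, v, Equiv.swap_apply_right] at this
          simp at this
        · simp [hg, e2] at h1
    · simp

lemma trace_block (k : ℕ) (hN : 0 < N) :
    (ascP (skp k (Rm (SF C N) 1)) 0 (N-1)).trace =
      ∑ f : SF C N, ∏ i ∈ Finset.range (N-1),
        (if k ∣ i + 1 then 1 else (1 : ℝ) / ((cnt f.1 (i+1) - cnt f.1 i : ℤ) : ℝ)) := by
  rw [Matrix.trace]
  apply Finset.sum_congr rfl
  intro f _
  rw [Matrix.diag_apply, diag_asc k 0 (N-1) (by omega)]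
  apply Finset.prod_congr rfl
  intro i _
  rw [zero_add, Rq, rq_one]

end


/-! ### Partial fractions -/

section
variable {ι : Type*} [DecidableEq ι]

lemma partial_fractions (S : Finset ι) (hS : S.Nonempty) (x : ι → ℝ) (hx : Set.InjOn x S) (y : ℝ) (hy : ∀ i ∈ S, y ≠ x i) :
    ∑ j ∈ S, (y - x j)⁻¹ * ∏ l ∈ S.erase j, (x j - x l)⁻¹ = ∏ j ∈ S, (y - x j)⁻¹ := by
  have h := Lagrange.eval_interpolate_not_at_node (s := S) (v := x) (r := 1) (x := y) hy
  rw [Lagrange.interpolate_one hx hS, Polynomial.eval_one, Lagrange.eval_nodal] at h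
  have hne : ∏ i ∈ S, (y - x i) ≠ 0 := Finset.prod_ne_zero_iff.2 (fun i hi => sub_ne_zero.2 (hy i hi))
  rw [Finset.prod_inv_distrib]
  rw [← eq_inv_of_mul_eq_one_right h.symm]
  apply Finset.sum_congr rfl
  intro i _
  simp only [Lagrange.nodalWeight, Pi.one_apply, mul_one]
  rw [mul_comm]

lemma lagrange_zero (S : Finset ι) (hS : 2 ≤ S.card) (x : ι → ℝ) (hx : Set.InjOn x S) :
    ∑ j ∈ S, ∏ l ∈ S.erase j, (x j - x l)⁻¹ = 0 := by
  obtain ⟨a, ha⟩ : S.Nonempty := Finset.card_pos.1 (by omega)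
  have hc : (S.erase a).card = S.card - 1 := Finset.card_erase_of_mem ha
  have hne : (S.erase a).Nonempty := Finset.card_pos.1 (by omega)
  have hinj : Set.InjOn x (S.erase a) := hx.mono (by intro i hi; exact Finset.mem_of_mem_erase hi)
  have hpf := partial_fractions (S.erase a) hne x hinj (x a) (by
    intro i hi h
    exact Finset.ne_of_mem_erase hi (hx (Finset.mem_of_mem_erase hi) ha h.symm))
  rw [← Finset.add_sum_erase _ _ ha, ← hpf, ← Finset.sum_add_distrib]
  apply Finset.sum_eq_zero
  intro j hj
  have hja := Finset.ne_of_mem_erase hj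
  have : S.erase j = insert a ((S.erase a).erase j) := by
    ext l
    simp only [Finset.mem_erase, Finset.mem_insert]
    by_cases h : l = a
    · subst h; simp [ha, hja.symm]
    · simp [h]
  rw [this, Finset.prod_insert (by simp), ← add_mul, ← neg_sub (x j) (x a), inv_neg, neg_add_cancel, zero_mul]

end

/-! ### The functional `V` -/

section
variable {b : ℕ}

/-- weighted sum over compositions -/
noncomputable def Vf (g : (Fin b → ℤ) → ℝ) (r : ℕ) (x : Fin b → ℤ) (y : ℤ) : ℝ :=
  ∑ m ∈ Finset.piAntidiag Finset.univ r,
    (∏ j ∈ Finset.univ.filter (fun j => m j ≠ 0), ((y:ℝ) - x j)⁻¹) * g (fun i => x i - m i)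

lemma Vf_zero (g : (Fin b → ℤ) → ℝ) (x : Fin b → ℤ) (y : ℤ) : Vf g 0 x y = g x := by
  simp [Vf]

lemma Vf_step (g : (Fin b → ℤ) → ℝ) (r : ℕ) (x : Fin b → ℤ) (j : Fin b) :
    Vf g r (x - Pi.single j 1) (x j) =
    ∑ m ∈ (Finset.piAntidiag Finset.univ (r+1)).filter (fun m => m j ≠ 0),
      (∏ l ∈ (Finset.univ.filter (fun j => m j ≠ 0)).erase j, ((x j : ℝ) - x l)⁻¹) * g (fun i => x i - m i) := by
  unfold Vf
  refine Finset.sum_bij' (fun m _ => m + Pi.single j 1) (fun m _ => m - Pi.single j 1) ?_ ?_ ?_ ?_ ?_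
  · intro m hm
    simp only [Finset.mem_piAntidiag, Finset.mem_filter] at hm ⊢
    refine ⟨⟨?_, by simp⟩, by simp⟩
    simp [Finset.sum_add_distrib, hm.1]
  · intro m hm
    simp only [Finset.mem_piAntidiag, Finset.mem_filter] at hm ⊢
    refine ⟨?_, by simp⟩
    have h1 : m = (m - Pi.single j 1) + Pi.single j 1 := by
      funext i
      by_cases h : i = j
      · subst h; simp; omega
      · simp [h]
    have h2 := hm.1.1
    rw [h1] at h2
    simp only [Pi.add_apply, Finset.sum_add_distrib, Finset.sum_pi_single'] at h2
    simpa using h2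
  · intro m hm
    funext i
    simp
  · intro m hm
    simp only [Finset.mem_piAntidiag, Finset.mem_filter] at hm
    funext i
    by_cases h : i = j
    · subst h; simp; omega
    · simp [h]
  · intro m hm
    congr 1
    · have e1 : (Finset.univ.filter (fun l => (m + Pi.single j 1 : Fin b → ℕ) l ≠ 0)).erase j =
          (Finset.univ.filter (fun l => m l ≠ 0)).erase j := by
        ext l
        simp only [Finset.mem_erase, Finset.mem_filter]
        by_cases h : l = j
        · simp [h]
        · simp [h]
      rw [e1]
      rw [← Finset.prod_erase (a := j) _ (by simp)]
      apply Finset.prod_congr rfl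
      intro l hl
      have := Finset.ne_of_mem_erase hl
      simp [this]
    · congr 1
      funext i
      simp only [Pi.sub_apply, Pi.add_apply]
      by_cases h : i = j
      · subst h; simp; ring
      · simp [h]

lemma Vf_sum (g : (Fin b → ℤ) → ℝ) (r : ℕ) (x : Fin b → ℤ) (a : Fin b → ℝ) :
    ∑ j, a j * Vf g r (x - Pi.single j 1) (x j) =
    ∑ m ∈ Finset.piAntidiag Finset.univ (r+1), (∑ j ∈ Finset.univ.filter (fun j => m j ≠ 0),
      a j * ∏ l ∈ (Finset.univ.filter (fun j => m j ≠ 0)).erase j, ((x j : ℝ) - x l)⁻¹) * g (fun i => x i - m i) := by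
  simp only [Vf_step, Finset.mul_sum, Finset.sum_mul, Finset.sum_filter]
  rw [Finset.sum_comm]
  apply Finset.sum_congr rfl
  intro m _
  apply Finset.sum_congr rfl
  intro j _
  split_ifs
  · ring
  · simp

lemma supp_ne {r : ℕ} {m : Fin b → ℕ} (hm : m ∈ Finset.piAntidiag Finset.univ (r+1)) :
    (Finset.univ.filter (fun j => m j ≠ 0)).Nonempty := by
  rw [Finset.mem_piAntidiag] at hm
  by_contra h
  rw [Finset.not_nonempty_iff_eq_empty, Finset.filter_eq_empty_iff] at h
  have : ∑ i, m i = 0 := Finset.sum_eq_zero (fun i hi => by simpa using h hi)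
  rw [hm.1] at this
  omega

lemma Vf_succ (g : (Fin b → ℤ) → ℝ) (r : ℕ) (x : Fin b → ℤ) (hx : Function.Injective x) (y : ℤ) (hy : ∀ j, y ≠ x j) :
    ∑ j, ((y:ℝ) - x j)⁻¹ * Vf g r (x - Pi.single j 1) (x j) = Vf g (r+1) x y := by
  rw [Vf_sum, Vf]
  apply Finset.sum_congr rfl
  intro m hm
  congr 1
  have := partial_fractions (Finset.univ.filter (fun j => m j ≠ 0)) (supp_ne hm) (fun j => (x j : ℝ))
    (fun i _ j _ h => hx (by simpa using h)) (y:ℝ) (fun i _ => by exact_mod_cast hy i)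
  exact this

lemma Vf_last (g : (Fin b → ℤ) → ℝ) (r : ℕ) (x : Fin b → ℤ) (hx : Function.Injective x) :
    ∑ j, Vf g r (x - Pi.single j 1) (x j) = ∑ j, g (x - Pi.single j ((r:ℤ)+1)) := by
  have h := Vf_sum g r x (fun _ => 1)
  simp only [one_mul] at h
  rw [h]
  symm
  apply Finset.sum_of_injOn (fun j : Fin b => (Pi.single j (r+1) : Fin b → ℕ))
  · intro i _ j _ h
    by_contra hne
    have := congrFun h i
    simp [hne] at this
  · intro j _
    simp
  · intro m hm hnot
    have hne := supp_ne hm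
    have hcard : 2 ≤ (Finset.univ.filter (fun j => m j ≠ 0)).card := by
      by_contra hc
      have h1 : (Finset.univ.filter (fun j => m j ≠ 0)).card = 1 := by
        have := Finset.card_pos.2 hne
        omega
      obtain ⟨j, hj⟩ := Finset.card_eq_one.1 h1
      apply hnot
      refine ⟨j, by simp, ?_⟩
      have hz : ∀ i, i ≠ j → m i = 0 := by
        intro i hi
        by_contra h
        have : i ∈ Finset.univ.filter (fun j => m j ≠ 0) := by simp [h]
        rw [hj] at this
        exact hi (by simpa using this)
      rw [Finset.mem_piAntidiag] at hm
      have h2 := hm.1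
      rw [Finset.sum_eq_single j (fun i _ hi => hz i hi) (by simp)] at h2
      funext i
      by_cases h : i = j
      · subst h; simp [h2]
      · simp [h, hz i h]
    have := lagrange_zero _ hcard (fun j => (x j : ℝ)) (fun i _ j _ h => hx (by simpa using h))
    rw [this, zero_mul]
  · intro j _
    have e : (Finset.univ.filter (fun l => (Pi.single j (r+1) : Fin b → ℕ) l ≠ 0)) = {j} := by
      ext l
      by_cases h : l = j
      · subst h; simp
      · simp [h]
    rw [e]
    simp only [Finset.sum_singleton, Finset.erase_singleton, Finset.prod_empty, one_mul]
    congr 1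
    funext i
    by_cases h : i = j
    · subst h; simp
    · simp [h]

lemma Vf_antisymm (g : (Fin b → ℤ) → ℝ) (r : ℕ) (x : Fin b → ℤ) (y : ℤ) (p p' : Fin b) (_hp : p ≠ p')
    (hg : ∀ z : Fin b → ℤ, g (z ∘ Equiv.swap p p') = - g z) (hx : x p = x p') : Vf g r x y = 0 := by
  have hxs : x ∘ Equiv.swap p p' = x := by
    funext i
    simp only [Function.comp, Equiv.swap_apply_def]
    split_ifs with h1 h2
    · rw [h1, hx]
    · rw [h2, hx]
    · rfl
  have key : ∀ m : Fin b → ℕ,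
      (∏ j ∈ Finset.univ.filter (fun j => m j ≠ 0), ((y:ℝ) - x j)⁻¹) * g (fun i => x i - m i) +
      (∏ j ∈ Finset.univ.filter (fun j => (m ∘ Equiv.swap p p') j ≠ 0), ((y:ℝ) - x j)⁻¹) *
        g (fun i => x i - (m ∘ Equiv.swap p p') i) = 0 := by
    intro m
    have e1 : (fun i => x i - ((m ∘ Equiv.swap p p') i : ℕ)) = (fun i => x i - (m i : ℤ)) ∘ Equiv.swap p p' := by
      funext i
      have := congrFun hxs i
      simp only [Function.comp] at this ⊢
      rw [this]
    have e2 : (∏ j ∈ Finset.univ.filter (fun j => (m ∘ Equiv.swap p p') j ≠ 0), ((y:ℝ) - x j)⁻¹) =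
        ∏ j ∈ Finset.univ.filter (fun j => m j ≠ 0), ((y:ℝ) - x j)⁻¹ := by
      simp only [Finset.prod_filter]
      apply Fintype.prod_equiv (Equiv.swap p p')
      intro i
      have := congrFun hxs i
      simp only [Function.comp] at this ⊢
      rw [this]
    rw [e1, e2, hg]; ring
  unfold Vf
  have hs : ∑ m ∈ Finset.piAntidiag Finset.univ r,
      (∏ j ∈ Finset.univ.filter (fun j => m j ≠ 0), ((y:ℝ) - x j)⁻¹) * g (fun i => x i - m i) =
      ∑ m ∈ Finset.piAntidiag Finset.univ r,
      (∏ j ∈ Finset.univ.filter (fun j => (m ∘ Equiv.swap p p') j ≠ 0), ((y:ℝ) - x j)⁻¹) *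
        g (fun i => x i - (m ∘ Equiv.swap p p') i) := by
    have hmem : ∀ m : Fin b → ℕ, m ∈ Finset.piAntidiag Finset.univ r →
        m ∘ Equiv.swap p p' ∈ Finset.piAntidiag Finset.univ r := by
      intro m hm
      rw [Finset.mem_piAntidiag] at hm ⊢
      refine ⟨?_, by simp⟩
      rw [← hm.1]
      exact Equiv.sum_comp (Equiv.swap p p') m
    have hinv : ∀ m : Fin b → ℕ, (m ∘ Equiv.swap p p') ∘ Equiv.swap p p' = m := by
      intro m; funext i; simp
    apply Finset.sum_bij' (fun m _ => m ∘ Equiv.swap p p') (fun m _ => m ∘ Equiv.swap p p')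
    · exact fun m hm => hmem m hm
    · exact fun m hm => hmem m hm
    · exact fun m _ => hinv m
    · exact fun m _ => hinv m
    · intro m _
      rw [hinv]
  have h2 := Finset.sum_congr (rfl : Finset.piAntidiag (Finset.univ : Finset (Fin b)) r = _) (fun m _ => key m)
  rw [Finset.sum_add_distrib, ← hs, Finset.sum_const_zero] at h2
  linarith

lemma Vf_vanish (g : (Fin b → ℤ) → ℝ) (r : ℕ) (x : Fin b → ℤ) (y : ℤ) (p : Fin b)
    (hg : ∀ z : Fin b → ℤ, z p < -b → g z = 0) (hx : x p < -b) : Vf g r x y = 0 := by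
  unfold Vf
  apply Finset.sum_eq_zero
  intro m _
  rw [hg _ (by show x p - (m p : ℤ) < -b; omega), mul_zero]

end

/-! ### The determinants -/

/-- entries -/
noncomputable def phi (k : ℕ) (u : ℤ) : ℝ := if (k:ℤ) ∣ u ∧ 0 ≤ u then 1 / ((u / k).toNat.factorial : ℝ) else 0

lemma phi_shift (k : ℕ) (hk : 0 < k) (u : ℤ) : phi k (u - k) = (u : ℝ) / k * phi k u := by
  unfold phi
  have hk' : (0:ℤ) < k := by exact_mod_cast hk
  by_cases hd : (k:ℤ) ∣ u
  · obtain ⟨c, rfl⟩ := hd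
    have e1 : (k:ℤ) * c - k = k * (c - 1) := by ring
    rw [e1]
    have h0 : ∀ c : ℤ, (0 ≤ (k:ℤ) * c) ↔ 0 ≤ c := fun c => mul_nonneg_iff_of_pos_left hk'
    have hdv : ∀ c, (k:ℤ) ∣ k*c := dvd_mul_right _
    simp only [hdv, true_and, h0, Int.mul_ediv_cancel_left _ hk'.ne']
    have e2 : (((k:ℤ) * c : ℤ) : ℝ) / k = c := by
      have : (k:ℝ) ≠ 0 := by exact_mod_cast hk.ne'
      push_cast; field_simp
    rw [e2]
    rcases lt_trichotomy c 0 with h | h | h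
    · rw [if_neg (by omega), if_neg (by omega), mul_zero]
    · subst h; simp
    · obtain ⟨t, rfl⟩ : ∃ t : ℕ, c = t + 1 := ⟨(c-1).toNat, by omega⟩
      rw [if_pos (by omega), if_pos (by omega)]
      have e3 : ((t:ℤ) + 1 - 1).toNat = t := by omega
      have e4 : ((t:ℤ) + 1).toNat = t + 1 := by omega
      rw [e3, e4, Nat.factorial_succ]
      have : (t.factorial : ℝ) ≠ 0 := by exact_mod_cast t.factorial_ne_zero
      push_cast
      field_simp
  · have : ¬ (k:ℤ) ∣ u - k := by
      intro h
      exact hd ((dvd_sub_self_right).1 h)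
    simp [hd, this]

section
variable {b : ℕ}

/-- the determinant -/
noncomputable def Gd (k d : ℕ) (x : Fin b → ℤ) : ℝ :=
  (d.factorial : ℝ) * (Matrix.of fun i j : Fin b => phi k (x i + j + 1)).det

lemma Gd_swap (k d : ℕ) (p p' : Fin b) (hp : p ≠ p') (z : Fin b → ℤ) : Gd k d (z ∘ Equiv.swap p p') = - Gd k d z := by
  unfold Gd
  have := Matrix.det_permute (Equiv.swap p p') (Matrix.of fun i j : Fin b => phi k (z i + j + 1))
  have e : (Matrix.of fun i j : Fin b => phi k ((z ∘ Equiv.swap p p') i + j + 1)) =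
    (Matrix.of fun i j : Fin b => phi k (z i + j + 1)).submatrix (Equiv.swap p p') id := rfl
  rw [e, this, Equiv.Perm.sign_swap hp]
  simp

lemma Gd_neg (k d : ℕ) (p : Fin b) (z : Fin b → ℤ) (hz : z p < -b) : Gd k d z = 0 := by
  unfold Gd
  rw [Matrix.det_eq_zero_of_row_eq_zero p, mul_zero]
  intro j
  have := j.2
  rw [Matrix.of_apply, phi, if_neg]
  omega

lemma Gd_sum (k d : ℕ) (hk : 0 < k) (x : Fin b → ℤ) (hx : ∑ i : Fin b, (x i + i + 1) = k * (d+1)) :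
    ∑ j, Gd k d (x - Pi.single j (k:ℤ)) = Gd k (d+1) x := by
  unfold Gd
  rw [← Finset.mul_sum, Nat.factorial_succ, Nat.cast_mul, mul_comm ((d+1 : ℕ):ℝ), mul_assoc]
  congr 1
  simp only [Matrix.det_apply']
  rw [Finset.sum_comm, Finset.mul_sum]
  apply Finset.sum_congr rfl
  intro σ _
  rw [← Finset.mul_sum, mul_left_comm]
  congr 1
  have e : ∀ j : Fin b, ∏ i, (Matrix.of fun i j' : Fin b => phi k ((x - Pi.single j (k:ℤ) : Fin b → ℤ) i + j' + 1)) (σ i) i =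
      (((x j + (σ.symm j : Fin b) + 1 : ℤ) : ℝ) / k) * ∏ i, (Matrix.of fun i j : Fin b => phi k (x i + j + 1)) (σ i) i := by
    intro j
    rw [← Finset.mul_prod_erase _ _ (Finset.mem_univ (σ.symm j)), ← Finset.mul_prod_erase _ (fun i => (Matrix.of fun i j : Fin b => phi k (x i + j + 1)) (σ i) i) (Finset.mem_univ (σ.symm j)), ← mul_assoc]
    congr 1
    · simp only [Matrix.of_apply, Equiv.apply_symm_apply, Pi.sub_apply, Pi.single_eq_same]
      rw [← phi_shift k hk]
      congr 1; ring
    · apply Finset.prod_congr rfl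
      intro i hi
      have h1 : σ i ≠ j := by
        intro h
        apply Finset.ne_of_mem_erase hi
        rw [← h]; simp
      simp [h1]
  simp only [e]
  rw [← Finset.sum_mul]
  congr 1
  rw [← Finset.sum_div]
  have hk' : (k:ℝ) ≠ 0 := by exact_mod_cast hk.ne'
  rw [div_eq_iff hk']
  have e2 : ∑ j, (x j + ((σ.symm j : Fin b) : ℤ) + 1) = k * (d+1) := by
    rw [← hx]
    simp only [Finset.sum_add_distrib]
    congr 2
    exact Equiv.sum_comp σ.symm (fun i : Fin b => ((i : ℕ) : ℤ))
  rw [← Int.cast_sum, e2]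
  push_cast; ring

lemma Gd_zero (k : ℕ) (hk : 0 < k) : Gd k 0 (fun i : Fin b => -1 - (i:ℤ)) = 1 := by
  unfold Gd
  rw [Matrix.det_of_isUpperTriangular]
  · simp [phi]
  · intro i j hij
    simp only [id] at hij
    have : (j : ℕ) < i := hij
    rw [Matrix.of_apply, phi, if_neg]
    beta_reduce
    omega

end


/-! ### Removing the largest entry -/

namespace SFl
variable {C C' : ℕ × ℕ → Prop} {N : ℕ} {f : Fil}

lemma remove_mem {c0 : ℕ × ℕ} (hC' : ∀ c, C' c ↔ C c ∧ c ≠ c0) (hf : IsStdFilling C (N+1) f)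
    (h0 : f c0 = N + 1) : IsStdFilling C' N (Function.update f c0 0) := by
  obtain ⟨f1, f2, f3, f4, f5, f6⟩ := hf
  have hc0 : C c0 := by
    by_contra h
    have := f1 _ h
    omega
  have hne : ∀ c, C' c → Function.update f c0 0 c = f c := by
    intro c hc
    rw [Function.update_of_ne ((hC' c).1 hc).2]
  refine ⟨?_, ?_, ?_, ?_, ?_, ?_⟩
  · intro c hc
    by_cases h : c = c0
    · subst h; simp
    · rw [Function.update_of_ne h]
      apply f1
      intro h'
      exact hc ((hC' c).2 ⟨h', h⟩)
  · intro c hc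
    rw [hne c hc]
    have h1 := (hC' c).1 hc
    have h2 := f2 c h1.1
    refine ⟨h2.1, ?_⟩
    have : f c ≠ N + 1 := by
      intro h
      exact h1.2 (f3 _ _ h1.1 hc0 (by omega))
    omega
  · intro c c' hc hc' h
    rw [hne c hc, hne c' hc'] at h
    exact f3 _ _ ((hC' c).1 hc).1 ((hC' c').1 hc').1 h
  · intro v hv1 hv2
    obtain ⟨c, hc, hv⟩ := f4 v hv1 (by omega)
    have : C' c := (hC' c).2 ⟨hc, by rintro rfl; omega⟩
    exact ⟨c, this, by rw [hne c this, hv]⟩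
  · intro a b h1 h2
    rw [hne _ h1, hne _ h2]
    exact f5 _ _ ((hC' _).1 h1).1 ((hC' _).1 h2).1
  · intro a b h1 h2
    rw [hne _ h1, hne _ h2]
    exact f6 _ _ ((hC' _).1 h1).1 ((hC' _).1 h2).1

lemma insert_mem {c0 : ℕ × ℕ} (hC' : ∀ c, C' c ↔ C c ∧ c ≠ c0) (hc0 : C c0) (hr : ¬ C (c0.1, c0.2+1))
    (hd : ¬ C (c0.1+1, c0.2)) (hf : IsStdFilling C' N f) :
    IsStdFilling C (N+1) (Function.update f c0 (N+1)) := by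
  obtain ⟨f1, f2, f3, f4, f5, f6⟩ := hf
  have hne : ∀ c, c ≠ c0 → Function.update f c0 (N+1) c = f c := by
    intro c hc
    rw [Function.update_of_ne hc]
  have hlt : ∀ c, C c → c ≠ c0 → f c < N + 1 := by
    intro c h1 h2
    have := f2 c ((hC' c).2 ⟨h1, h2⟩)
    omega
  refine ⟨?_, ?_, ?_, ?_, ?_, ?_⟩
  · intro c hc
    have h : c ≠ c0 := by rintro rfl; exact hc hc0
    rw [hne c h]
    exact f1 _ (fun h' => hc ((hC' c).1 h').1)
  · intro c hc
    by_cases h : c = c0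
    · subst h; simp
    · rw [hne c h]
      have := f2 c ((hC' c).2 ⟨hc, h⟩)
      omega
  · intro c c' hc hc' h
    by_cases e : c = c0
    · by_cases e' : c' = c0
      · rw [e, e']
      · rw [hne c' e', e, Function.update_self] at h
        have := hlt c' hc' e'
        omega
    · by_cases e' : c' = c0
      · rw [hne c e, e', Function.update_self] at h
        have := hlt c hc e
        omega
      · rw [hne c e, hne c' e'] at h
        exact f3 _ _ ((hC' c).2 ⟨hc, e⟩) ((hC' c').2 ⟨hc', e'⟩) h
  · intro v hv1 hv2
    by_cases h : v = N + 1
    · exact ⟨c0, hc0, by rw [Function.update_self, h]⟩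
    · obtain ⟨c, hc, hv⟩ := f4 v hv1 (by omega)
      have := (hC' c).1 hc
      exact ⟨c, this.1, by rw [hne c this.2, hv]⟩
  · intro a b h1 h2
    have e : (a, b) ≠ c0 := by rintro rfl; exact hr h2
    rw [hne _ e]
    by_cases e' : (a, b+1) = c0
    · rw [e', Function.update_self]
      exact hlt _ h1 e
    · rw [hne _ e']
      exact f5 _ _ ((hC' _).2 ⟨h1, e⟩) ((hC' _).2 ⟨h2, e'⟩)
  · intro a b h1 h2
    have e : (a, b) ≠ c0 := by rintro rfl; exact hd h2
    rw [hne _ e]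
    by_cases e' : (a+1, b) = c0
    · rw [e', Function.update_self]
      exact hlt _ h1 e
    · rw [hne _ e']
      exact f6 _ _ ((hC' _).2 ⟨h1, e⟩) ((hC' _).2 ⟨h2, e'⟩)

lemma max_cell (hf : IsStdFilling C N f) {c0 : ℕ × ℕ} (hc0 : C c0) (h : f c0 = N) :
    ¬ C (c0.1, c0.2+1) ∧ ¬ C (c0.1+1, c0.2) := by
  obtain ⟨f1, f2, f3, f4, f5, f6⟩ := hf
  constructor
  · intro h'
    have h1 := f5 c0.1 c0.2 hc0 h'
    have h2 := f2 _ h'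
    have : f (c0.1, c0.2) = N := h
    omega
  · intro h'
    have h1 := f6 c0.1 c0.2 hc0 h'
    have h2 := f2 _ h'
    have : f (c0.1, c0.2) = N := h
    omega

end SFl

/-- finset of standard fillings -/
noncomputable def SFf (C : ℕ × ℕ → Prop) (N : ℕ) : Finset Fil :=
  open Classical in if h : (SF C N).Finite then h.toFinset else ∅

lemma mem_SFf {C : ℕ × ℕ → Prop} {N : ℕ} (h : {c | C c}.Finite) (f : Fil) : f ∈ SFf C N ↔ IsStdFilling C N f := by
  unfold SFf
  rw [dif_pos (SFl.fin h), Set.Finite.mem_toFinset]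
  rfl

/-- the weight of a filling -/
noncomputable def Wf (k N : ℕ) (y : ℤ) (f : Fil) : ℝ :=
  ∏ i ∈ Finset.range N, if k ∣ i + 1 then 1 else (((if i + 1 = N then y else cnt f (i+1)) : ℝ) - cnt f i)⁻¹

lemma Wf_succ (k N : ℕ) (y : ℤ) (f g : Fil) (h : ∀ i < N, cnt f i = cnt g i) :
    Wf k (N+1) y f = (if k ∣ N + 1 then 1 else ((y:ℝ) - cnt f N)⁻¹) * Wf k N (cnt f N) g := by
  unfold Wf
  rw [Finset.prod_range_succ, mul_comm]
  congr 1
  · simp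
  · apply Finset.prod_congr rfl
    intro i hi
    rw [Finset.mem_range] at hi
    rw [if_neg (show i + 1 ≠ N + 1 by omega), h i hi]
    by_cases e : i + 1 = N
    · simp [e]
    · rw [if_neg e, h (i+1) (by omega)]

/-! ### Young diagrams with at most `b` rows -/

section
variable {b : ℕ}

/-- cells -/
def YC (lam : Fin b → ℕ) (c : ℕ × ℕ) : Prop := ∃ h : c.1 < b, c.2 < lam ⟨c.1, h⟩

lemma YC_fin (lam : Fin b → ℕ) : {c | YC lam c}.Finite := by
  apply (Finset.range b ×ˢ Finset.range (∑ i, lam i + 1)).finite_toSet.subset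
  rintro c ⟨h, h'⟩
  have : lam ⟨c.1, h⟩ ≤ ∑ i, lam i := Finset.single_le_sum (f := lam) (fun _ _ => Nat.zero_le _) (Finset.mem_univ _)
  simp only [Finset.coe_product, Set.mem_prod, Finset.coe_range, Set.mem_Iio]
  exact ⟨h, by omega⟩

/-- weighted sum -/
noncomputable def WW (k : ℕ) (lam : Fin b → ℕ) (N : ℕ) (y : ℤ) : ℝ := ∑ f ∈ SFf (YC lam) N, Wf k N y f

/-- shifted content coordinates -/
def xc (lam : Fin b → ℕ) (j : Fin b) : ℤ := (lam j : ℤ) - 1 - j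

/-- removable rows -/
def Rmv (lam : Fin b → ℕ) (j : Fin b) : Prop := 0 < lam j ∧ ∀ l : Fin b, (l : ℕ) = j + 1 → lam l < lam j

open Classical in
lemma WW_rec (k : ℕ) (lam : Fin b → ℕ) (N : ℕ) (y : ℤ) :
    WW k lam (N+1) y = ∑ j, if Rmv lam j then
      (if k ∣ N + 1 then 1 else ((y:ℝ) - xc lam j)⁻¹) * WW k (lam - Pi.single j 1) N (xc lam j) else 0 := by
  have h1 : WW k lam (N+1) y = ∑ f ∈ SFf (YC lam) (N+1), ∑ j : Fin b,
      if f ((j:ℕ), lam j - 1) = N + 1 then Wf k (N+1) y f else 0 := by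
    unfold WW
    apply Finset.sum_congr rfl
    intro f hf
    rw [mem_SFf (YC_fin lam)] at hf
    have hts := SFl.tcell_spec hf (v := N+1) (by omega) le_rfl
    obtain ⟨c, hcdef⟩ : ∃ c, c = tcell f (N+1) := ⟨_, rfl⟩
    rw [← hcdef] at hts
    obtain ⟨⟨hb, hl⟩, hv⟩ := hts
    have hm := SFl.max_cell hf (c0 := c) ⟨hb, hl⟩ hv
    have hlast : c.2 = lam ⟨c.1, hb⟩ - 1 := by
      by_contra h
      exact hm.1 ⟨hb, by show c.2 + 1 < lam ⟨c.1, hb⟩; omega⟩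
    rw [Finset.sum_eq_single (⟨c.1, hb⟩ : Fin b)]
    · rw [if_pos]
      show f (c.1, lam ⟨c.1, hb⟩ - 1) = N + 1
      rw [← hlast]; exact hv
    · intro j _ hj
      rw [if_neg]
      intro h
      have := SFl.tcell_eq hf h (by omega)
      apply hj
      ext
      show (j:ℕ) = c.1
      rw [hcdef, this]
    · simp
  rw [h1, Finset.sum_comm]
  apply Finset.sum_congr rfl
  intro j _
  rw [← Finset.sum_filter]
  set c0 : ℕ × ℕ := ((j:ℕ), lam j - 1) with hc0
  split_ifs with hR hk
  all_goals try
    rw [WW, Finset.mul_sum]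
    have hC' : ∀ c, YC (lam - Pi.single j 1) c ↔ YC lam c ∧ c ≠ c0 := by
      rintro ⟨a, e⟩
      unfold YC
      by_cases haj : a = j
      · subst haj
        have := hR.1
        simp [hc0]
        omega
      · have : ∀ h : a < b, (⟨a, h⟩ : Fin b) ≠ j := by
          intro h h'
          exact haj (by rw [← h'])
        have h2 : (a, e) ≠ c0 := by
          intro h
          exact haj (congrArg Prod.fst h)
        simp [this, h2]
    have hC0 : YC lam c0 := ⟨j.2, by have := hR.1; show lam j - 1 < lam j; omega⟩
    have hr : ¬ YC lam (c0.1, c0.2+1) := by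
      rintro ⟨h, h'⟩
      have h2 : lam j - 1 + 1 < lam j := h'
      omega
    have hd : ¬ YC lam (c0.1+1, c0.2) := by
      rintro ⟨h, h'⟩
      have h2 := hR.2 ⟨(j:ℕ)+1, h⟩ rfl
      have h3 : lam j - 1 < lam ⟨(j:ℕ)+1, h⟩ := h'
      omega
    refine Finset.sum_bij' (fun f _ => Function.update f c0 0) (fun g _ => Function.update g c0 (N+1)) ?_ ?_ ?_ ?_ ?_
    · intro f hf
      rw [Finset.mem_filter, mem_SFf (YC_fin lam)] at hf
      rw [mem_SFf (YC_fin _)]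
      exact SFl.remove_mem hC' hf.1 hf.2
    · intro g hg
      rw [mem_SFf (YC_fin _)] at hg
      rw [Finset.mem_filter, mem_SFf (YC_fin lam)]
      exact ⟨SFl.insert_mem hC' hC0 hr hd hg, by simp⟩
    · intro f hf
      rw [Finset.mem_filter] at hf
      simp [← hf.2]
    · intro g hg
      rw [mem_SFf (YC_fin _)] at hg
      have : g c0 = 0 := hg.1 _ (by rw [hC']; simp)
      simp [← this]
    · intro f hf
      rw [Finset.mem_filter, mem_SFf (YC_fin lam)] at hf
      obtain ⟨hf, hv⟩ := hf
      have hcN : cnt f N = xc lam j := by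
        unfold cnt xc
        rw [SFl.tcell_eq hf hv (by omega)]
        have := hR.1
        simp only [hc0]
        omega
      have hg := SFl.remove_mem hC' hf hv
      rw [Wf_succ k N y f (Function.update f c0 0), hcN]
      · simp [hk]
      · intro i hi
        unfold cnt
        obtain ⟨hx1, hx2⟩ := SFl.tcell_spec hf (v := i+1) (by omega) (by omega)
        have : tcell (Function.update f c0 0) (i+1) = tcell f (i+1) := by
          apply SFl.tcell_eq hg _ (by omega)
          rw [Function.update_of_ne, hx2]
          intro h
          rw [h, hv] at hx2
          omega
        rw [this]
  · apply Finset.sum_eq_zero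
    intro f hf
    exfalso
    rw [Finset.mem_filter, mem_SFf (YC_fin lam)] at hf
    obtain ⟨hf, hv⟩ := hf
    have hc := SFl.cell_of_pos hf (c := c0) (by omega)
    have hm := SFl.max_cell hf hc hv
    obtain ⟨_, hc2⟩ := hc
    have hc3 : lam j - 1 < lam j := hc2
    apply hR
    refine ⟨by omega, ?_⟩
    intro l hl
    by_contra hcon
    apply hm.2
    have hb : (j:ℕ) + 1 < b := by rw [← hl]; exact l.2
    refine ⟨hb, ?_⟩
    have : l = ⟨(j:ℕ)+1, hb⟩ := Fin.ext hl
    rw [this] at hcon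
    show lam j - 1 < lam ⟨(j:ℕ)+1, hb⟩
    omega

end


/-! ### The Murnaghan–Nakayama evaluation -/

section
variable {b : ℕ}

lemma xc_inj (lam : Fin b → ℕ) (hl : Antitone lam) : Function.Injective (xc lam) := by
  intro i j h
  unfold xc at h
  rcases le_total i j with hij | hij
  · have h1 := hl hij
    have h2 : (i:ℕ) ≤ j := hij
    ext; omega
  · have h1 := hl hij
    have h2 : (j:ℕ) ≤ i := hij
    ext; omega

lemma xc_sub (lam : Fin b → ℕ) (j : Fin b) (h : 0 < lam j) :
    xc (lam - Pi.single j 1) = xc lam - Pi.single j 1 := by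
  funext i
  unfold xc
  by_cases e : i = j
  · subst e; simp; omega
  · simp [e]

lemma Rmv_anti (lam : Fin b → ℕ) (hl : Antitone lam) (j : Fin b) (h : Rmv lam j) :
    Antitone (lam - Pi.single j 1) := by
  intro i l hil
  have h0 := hl hil
  by_cases e : i = j
  · subst e
    by_cases e' : l = i
    · rw [e']
    · have hlt : (i:ℕ) < l := lt_of_le_of_ne hil (fun h => e' (Fin.ext h.symm))
      have hb : (i:ℕ) + 1 < b := by have := l.2; omega
      have h1 := h.2 ⟨(i:ℕ)+1, hb⟩ rfl
      have h2 : lam l ≤ lam ⟨(i:ℕ)+1, hb⟩ := hl (by show (i:ℕ) + 1 ≤ l; omega)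
      simp [e']; omega
  · by_cases e' : l = j
    · subst e'; simp [e]; omega
    · simpa [e, e'] using h0

lemma notRmv_zero (lam : Fin b → ℕ) (hl : Antitone lam) (j : Fin b) (h : ¬ Rmv lam j) (k d r : ℕ) (y : ℤ) :
    Vf (Gd k d) r (xc lam - Pi.single j 1) y = 0 := by
  by_cases hb : (j:ℕ) + 1 < b
  · set l : Fin b := ⟨(j:ℕ)+1, hb⟩ with hldef
    have hlj : l ≠ j := by
      intro h
      have := congrArg Fin.val h
      simp [hldef] at this
    have hle : lam l ≤ lam j := hl (by show (j:ℕ) ≤ j + 1; omega)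
    have heq : lam l = lam j := by
      by_contra hne
      apply h
      refine ⟨by omega, ?_⟩
      intro l' hl'
      have : l' = l := Fin.ext hl'
      rw [this]; omega
    apply Vf_antisymm _ _ _ _ j l hlj.symm (fun z => Gd_swap k d j l hlj.symm z)
    have hlv : (l:ℕ) = j + 1 := rfl
    rw [Pi.sub_apply, Pi.sub_apply, Pi.single_eq_same, Pi.single_eq_of_ne hlj]
    unfold xc
    rw [heq, hlv]
    push_cast; ring
  · have h0 : lam j = 0 := by
      by_contra hne
      apply h
      refine ⟨by omega, ?_⟩
      intro l' hl'
      have := l'.2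
      omega
    apply Vf_vanish _ _ _ _ j (fun z hz => Gd_neg k d j z hz)
    have := j.2
    simp [xc, h0]
    omega

lemma WW_eq (k : ℕ) (hk : 0 < k) : ∀ (N d r : ℕ) (lam : Fin b → ℕ) (y : ℤ), Antitone lam → r < k → N = k * d + r →
    ∑ i, lam i = N → (∀ j, y ≠ xc lam j) → WW k lam N y = Vf (Gd k d) r (xc lam) y := by
  intro N
  induction N with
  | zero =>
    intro d r lam y hl hr hN hsum hy
    have hr0 : r = 0 := by omega
    have hd0 : d = 0 := by
      have : k * d = 0 := by omega
      rcases Nat.mul_eq_zero.1 this with h | h <;> omega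
    subst hr0; subst hd0
    have hlam : lam = 0 := by
      funext i
      have : lam i ≤ ∑ i, lam i := Finset.single_le_sum (f := lam) (fun _ _ => Nat.zero_le _) (Finset.mem_univ _)
      simp; omega
    subst hlam
    rw [Vf_zero]
    have e : xc (0 : Fin b → ℕ) = fun i : Fin b => -1 - (i:ℤ) := by
      funext i; simp [xc]
    rw [e, Gd_zero k hk]
    have hno : ∀ c, ¬ YC (0 : Fin b → ℕ) c := by
      rintro c ⟨h, h'⟩
      simp at h'
    have hs : SFf (YC (0 : Fin b → ℕ)) 0 = {0} := by
      ext f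
      rw [mem_SFf (YC_fin _), Finset.mem_singleton]
      constructor
      · intro hf
        funext c
        exact hf.1 c (hno c)
      · rintro rfl
        refine ⟨fun _ _ => rfl, fun c hc => absurd hc (hno c), fun c _ hc => absurd hc (hno c), fun v h1 h2 => by omega,
          fun a b h => absurd h (hno _), fun a b h => absurd h (hno _)⟩
    simp [WW, hs, Wf]
  | succ N ih =>
    intro d r lam y hl hr hN hsum hy
    classical
    rw [WW_rec]
    have hsum' : ∀ j, Rmv lam j → ∑ i, (lam - Pi.single j 1 : Fin b → ℕ) i = N := by
      intro j hj
      have : lam = (lam - Pi.single j 1) + Pi.single j 1 := by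
        funext i
        by_cases h : i = j
        · subst h; have := hj.1; simp; omega
        · simp [h]
      rw [this] at hsum
      simp only [Pi.add_apply, Finset.sum_add_distrib] at hsum
      simp at hsum
      simpa using hsum
    have hy' : ∀ j, Rmv lam j → ∀ l, xc lam j ≠ xc (lam - Pi.single j 1) l := by
      intro j hj l
      rw [xc_sub lam j hj.1]
      by_cases e : l = j
      · subst e; simp; omega
      · intro h
        simp [e] at h
        exact e (xc_inj lam hl h.symm)
    by_cases hr0 : r = 0
    · subst hr0
      obtain ⟨d', rfl⟩ : ∃ d', d = d' + 1 := by
        cases d with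
        | zero => simp at hN
        | succ d' => exact ⟨d', rfl⟩
      have hdv : k ∣ N + 1 := ⟨d'+1, by omega⟩
      rw [Vf_zero, ← Gd_sum k d' hk]
      · have hk1 : ((k - 1 : ℕ) : ℤ) + 1 = k := by omega
        rw [← hk1, ← Vf_last (Gd k d') (k-1) (xc lam) (xc_inj lam hl)]
        apply Finset.sum_congr rfl
        intro j _
        split_ifs with hR
        · rw [one_mul, ih d' (k-1) _ _ (Rmv_anti lam hl j hR) (by omega) (by rw [mul_add] at hN; omega) (hsum' j hR) (hy' j hR),
            xc_sub lam j hR.1]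
        · rw [notRmv_zero lam hl j hR]
      · have : ∀ i : Fin b, xc lam i + i + 1 = (lam i : ℤ) := by
          intro i; unfold xc; ring
        simp only [this]
        rw [← Nat.cast_sum, hsum, hN]
        push_cast; ring
    · obtain ⟨r', rfl⟩ : ∃ r', r = r' + 1 := ⟨r - 1, by omega⟩
      have hdv : ¬ k ∣ N + 1 := by
        rw [hN, Nat.dvd_add_right (dvd_mul_right k d)]
        intro h
        have := Nat.le_of_dvd (by omega) h
        omega
      rw [← Vf_succ (Gd k d) r' (xc lam) (xc_inj lam hl) y hy]
      apply Finset.sum_congr rfl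
      intro j _
      split_ifs with hR
      · rw [ih d r' _ _ (Rmv_anti lam hl j hR) (by omega) (by omega) (hsum' j hR) (hy' j hR), xc_sub lam j hR.1]
      · rw [notRmv_zero lam hl j hR, mul_zero]

lemma YC_rect (b n : ℕ) : YC (fun _ : Fin b => n) = RC b n := by
  funext c
  rw [eq_iff_iff, RC_iff]
  unfold YC
  simp

/-- the trace as a determinant -/
lemma block_det (n k d : ℕ) (hk : 0 < k) (hN : 0 < b * n) (hkd : k * d = b * n) [Fintype (SF (RC b n) (b*n))] :
    ∑ f : SF (RC b n) (b*n), ∏ i ∈ Finset.range (b*n-1),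
        (if k ∣ i + 1 then 1 else (1 : ℝ) / ((cnt f.1 (i+1) - cnt f.1 i : ℤ) : ℝ)) =
    (d.factorial : ℝ) * (Matrix.of fun i j : Fin b => phi k ((n:ℤ) - i + j)).det := by
  have h := WW_eq (b := b) k hk (b*n) d 0 (fun _ => n) n (fun _ _ _ => le_rfl) hk (by omega) (by simp)
    (by intro j; unfold xc; beta_reduce; omega)
  rw [Vf_zero, Gd] at h
  have e : (Matrix.of fun i j : Fin b => phi k ((n:ℤ) - i + j)) =
      Matrix.of fun i j : Fin b => phi k (xc (fun _ : Fin b => n) i + j + 1) := by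
    ext i j
    simp only [Matrix.of_apply]
    congr 1
    unfold xc; ring
  rw [e, ← h, WW, YC_rect]
  have hs : ∀ f, f ∈ SFf (RC b n) (b*n) ↔ f ∈ SF (RC b n) (b*n) := fun f => mem_SFf (RC_finite b n) f
  have hsub : ∀ g : Fil → ℝ, ∑ f ∈ SFf (RC b n) (b*n), g f = ∑ f : SF (RC b n) (b*n), g f.1 :=
    fun g => Finset.sum_subtype _ hs g
  rw [hsub]
  apply Finset.sum_congr rfl
  intro f _
  unfold Wf
  generalize f.1 = f
  obtain ⟨M, hM⟩ : ∃ M, b * n = M + 1 := ⟨b*n-1, by omega⟩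
  rw [hM, Finset.prod_range_succ, if_pos (show k ∣ M + 1 by rw [← hM, ← hkd]; exact dvd_mul_right k d), mul_one]
  apply Finset.prod_congr rfl
  intro i hi
  rw [Finset.mem_range] at hi
  rw [if_neg (show i + 1 ≠ M + 1 by omega)]
  push_cast
  rw [one_div]

end


/-! ### The `q`-hook formula as a determinant -/

open Polynomial

lemma qInt_succ (m : ℕ) : qInt (m+1) = qInt m + X ^ m := by
  unfold qInt; rw [Finset.sum_range_succ]

lemma qInt_zero : qInt 0 = 0 := by simp [qInt]

lemma qInt_add (a c : ℕ) : qInt (a + c) = qInt a + X ^ a * qInt c := by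
  induction c with
  | zero => simp [qInt_zero]
  | succ c ih =>
    rw [← add_assoc, qInt_succ, ih, qInt_succ, pow_add]; ring

lemma qInt_monic (m : ℕ) (hm : 0 < m) : (qInt m).Monic := Polynomial.monic_geom_sum_X hm.ne'

lemma qInt_eval_zero (m : ℕ) (hm : 0 < m) : (qInt m).eval 0 = 1 := by
  obtain ⟨t, rfl⟩ : ∃ t, m = t + 1 := ⟨m - 1, by omega⟩
  unfold qInt
  rw [Finset.sum_range_succ', Polynomial.eval_add, Polynomial.eval_finsetSum]
  simp

lemma qFact_succ (m : ℕ) : qFact (m+1) = qFact m * qInt (m+1) := by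
  unfold qFact; rw [Finset.prod_range_succ]

lemma qFact_zero : qFact 0 = 1 := by simp [qFact]

lemma qFact_monic (m : ℕ) : (qFact m).Monic :=
  Polynomial.monic_prod_of_monic _ _ (fun i _ => qInt_monic (i+1) (by omega))

lemma qFact_ne (m : ℕ) : qFact m ≠ 0 := (qFact_monic m).ne_zero

lemma qFact_desc (m t : ℕ) (ht : t ≤ m) : (∏ s ∈ Finset.range t, qInt (m - s)) * qFact (m - t) = qFact m := by
  induction t with
  | zero => simp
  | succ t ih =>
    rw [← ih (by omega), Finset.prod_range_succ, mul_assoc]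
    congr 1
    rw [show m - t = (m - (t+1)) + 1 by omega, qFact_succ, mul_comm]

lemma qBinom_dvd (a c : ℕ) : qFact a * qFact c ∣ qFact (a + c) := by
  obtain ⟨s, hs⟩ : ∃ s, a + c = s := ⟨_, rfl⟩
  induction s generalizing a c with
  | zero =>
    have h1 : a = 0 := by omega
    have h2 : c = 0 := by omega
    subst h1; subst h2
    simp [qFact_zero]
  | succ s ih =>
    cases a with
    | zero => simp [qFact_zero]
    | succ a =>
      cases c with
      | zero => simp [qFact_zero]
      | succ c =>
        have e : qFact (a + 1 + (c + 1)) = qFact (a + c + 1) * qInt (a+1) + qFact (a+c+1) * (X ^ (a+1) * qInt (c+1)) := by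
          rw [← mul_add, ← qInt_add, show a + 1 + (c + 1) = (a + c + 1) + 1 by ring, qFact_succ]
        rw [e]
        apply dvd_add
        · have h := ih a (c+1) (by omega)
          rw [show a + (c + 1) = a + c + 1 by ring] at h
          rw [qFact_succ a, mul_right_comm]
          exact mul_dvd_mul_right h _
        · have h := ih (a+1) c (by omega)
          rw [show a + 1 + c = a + c + 1 by ring] at h
          rw [qFact_succ c, ← mul_assoc, mul_comm (X ^ (a+1)), ← mul_assoc]
          exact (mul_dvd_mul_right h _).mul_right _

lemma qMult_dvd {ι : Type*} (S : Finset ι) (c : ι → ℕ) : ∏ i ∈ S, qFact (c i) ∣ qFact (∑ i ∈ S, c i) := by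
  classical
  induction S using Finset.induction_on with
  | empty => simp [qFact_zero]
  | insert a S ha ih =>
    rw [Finset.prod_insert ha, Finset.sum_insert ha]
    exact (mul_dvd_mul_left _ ih).trans (qBinom_dvd _ _)

/-- the hook product -/
noncomputable def hookD (b n : ℕ) : Polynomial ℤ :=
  ∏ i ∈ Finset.range b, ∏ j ∈ Finset.range n, qInt (b + n - 1 - i - j)

lemma hookD_monic (b n : ℕ) : (hookD b n).Monic := by
  apply Polynomial.monic_prod_of_monic
  intro i hi
  apply Polynomial.monic_prod_of_monic
  intro j hj
  rw [Finset.mem_range] at hi hj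
  exact qInt_monic _ (by omega)

lemma hookD_eval (b n : ℕ) : (hookD b n).eval 0 = 1 := by
  unfold hookD
  rw [Polynomial.eval_prod]
  apply Finset.prod_eq_one
  intro i hi
  rw [Polynomial.eval_prod]
  apply Finset.prod_eq_one
  intro j hj
  rw [Finset.mem_range] at hi hj
  exact qInt_eval_zero _ (by omega)

lemma hookD_mul (b n : ℕ) : hookD b n * ∏ i ∈ Finset.range b, qFact i = ∏ i ∈ Finset.range b, qFact (n + i) := by
  unfold hookD
  rw [← Finset.prod_range_reflect, ← Finset.prod_mul_distrib]
  apply Finset.prod_congr rfl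
  intro i hi
  rw [Finset.mem_range] at hi
  rw [← qFact_desc (n+i) n (by omega), Nat.add_sub_cancel_left]
  congr 1
  apply Finset.prod_congr rfl
  intro j _
  congr 1
  omega

/-- the matrix of descending factorials -/
noncomputable def Qm (b n : ℕ) : Matrix (Fin b) (Fin b) (Polynomial ℤ) :=
  Matrix.of fun i j => ∏ s ∈ Finset.range (j:ℕ), qInt (n + i - s)

lemma desc_eval (m j : ℕ) : X ^ (∑ s ∈ Finset.range j, s) * ∏ s ∈ Finset.range j, qInt (m - s) =
    ∏ s ∈ Finset.range j, (qInt m - qInt s) := by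
  rw [← Finset.prod_pow_eq_pow_sum, ← Finset.prod_mul_distrib]
  by_cases h : j ≤ m + 1
  · apply Finset.prod_congr rfl
    intro s hs
    rw [Finset.mem_range] at hs
    obtain ⟨t, rfl⟩ : ∃ t, m = s + t := ⟨m - s, by omega⟩
    rw [Nat.add_sub_cancel_left, qInt_add]; ring
  · rw [Finset.prod_eq_zero (i := m) (by rw [Finset.mem_range]; omega) (by simp [qInt_zero]),
      Finset.prod_eq_zero (i := m) (by rw [Finset.mem_range]; omega) (by simp)]

lemma Qm_vand (b n : ℕ) : X ^ (∑ j : Fin b, ∑ s ∈ Finset.range (j:ℕ), s) * (Qm b n).det =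
    (Matrix.vandermonde (fun i : Fin b => qInt (n + i))).det := by
  rw [Matrix.det_eval_matrixOfPolynomials_eq_det_vandermonde (fun i : Fin b => qInt (n + i))
    (fun j : Fin b => ∏ s ∈ Finset.range (j:ℕ), (X - C (qInt s)))]
  · rw [← Finset.prod_pow_eq_pow_sum, ← Matrix.det_mul_row]
    congr 1
    ext1 i j
    simp only [Matrix.of_apply, Qm, Polynomial.eval_prod, Polynomial.eval_sub, Polynomial.eval_X, Polynomial.eval_C]
    exact desc_eval (n+i) j
  · intro j
    rw [Polynomial.natDegree_prod_of_monic _ _ (fun s _ => Polynomial.monic_X_sub_C _)]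
    simp
  · intro j
    exact Polynomial.monic_prod_of_monic _ _ (fun s _ => Polynomial.monic_X_sub_C _)

lemma prod_pairs {M : Type*} [CommMonoid M] (b : ℕ) (G : ℕ → ℕ → M) :
    ∏ i : Fin b, ∏ j ∈ Finset.Ioi i, G i j = ∏ j ∈ Finset.range b, ∏ i ∈ Finset.range j, G i j := by
  have h1 : ∀ i : Fin b, ∏ j ∈ Finset.Ioi i, G i j = ∏ j ∈ Finset.range b, if (i:ℕ) < j then G i j else 1 := by
    intro i
    rw [← Fin.prod_univ_eq_prod_range (fun j => if (i:ℕ) < j then G i j else 1) b, ← Finset.prod_filter]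
    apply Finset.prod_congr _ (fun _ _ => rfl)
    ext j
    simp
  simp only [h1]
  rw [Fin.prod_univ_eq_prod_range (fun i => ∏ j ∈ Finset.range b, if i < j then G i j else 1) b, Finset.prod_comm]
  apply Finset.prod_congr rfl
  intro j hj
  rw [← Finset.prod_filter]
  apply Finset.prod_congr _ (fun _ _ => rfl)
  ext i
  simp only [Finset.mem_filter, Finset.mem_range] at hj ⊢
  omega

lemma vand_eval (b n : ℕ) : (Matrix.vandermonde (fun i : Fin b => qInt (n + i))).det =
    X ^ (∑ j ∈ Finset.range b, ∑ s ∈ Finset.range j, (n + s)) * ∏ i ∈ Finset.range b, qFact i := by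
  rw [Matrix.det_vandermonde]
  rw [← Finset.prod_pow_eq_pow_sum, ← Finset.prod_mul_distrib]
  rw [prod_pairs b (fun i j => qInt (n + j) - qInt (n + i))]
  apply Finset.prod_congr rfl
  intro j _
  have h := qFact_desc j j le_rfl
  rw [Nat.sub_self, qFact_zero, mul_one] at h
  rw [← h, ← Finset.prod_pow_eq_pow_sum, ← Finset.prod_mul_distrib]
  apply Finset.prod_congr rfl
  intro s hs
  rw [Finset.mem_range] at hs
  rw [show n + j = (n + s) + (j - s) by omega, qInt_add]
  ring

lemma Qm_det (b n : ℕ) : (Qm b n).det = X ^ (n * ∑ j ∈ Finset.range b, j) * ∏ i ∈ Finset.range b, qFact i := by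
  have h := Qm_vand b n
  rw [vand_eval] at h
  have e : (∑ j ∈ Finset.range b, ∑ s ∈ Finset.range j, (n + s)) =
      (∑ j : Fin b, ∑ s ∈ Finset.range (j:ℕ), s) + n * ∑ j ∈ Finset.range b, j := by
    rw [Fin.sum_univ_eq_sum_range (fun j => ∑ s ∈ Finset.range j, s) b]
    rw [Finset.mul_sum, ← Finset.sum_add_distrib]
    apply Finset.sum_congr rfl
    intro j _
    rw [Finset.sum_add_distrib, Finset.sum_const, Finset.card_range, smul_eq_mul]
    ring
  rw [e, pow_add, mul_assoc] at h
  exact mul_left_cancel₀ (pow_ne_zero _ X_ne_zero) h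

lemma Qm_det_hook (b n : ℕ) : (Qm b n).det * hookD b n =
    X ^ (n * ∑ j ∈ Finset.range b, j) * ∏ i ∈ Finset.range b, qFact (n + i) := by
  rw [Qm_det, ← hookD_mul]; ring

/-- multinomial coefficients, zero in the degenerate case -/
lemma exists_mult (b n : ℕ) (σ : Equiv.Perm (Fin b)) : ∃ M : Polynomial ℤ,
    qFact (b * n) * ∏ i : Fin b, ∏ s ∈ Finset.range (σ i : ℕ), qInt (n + i - s) = M * ∏ i ∈ Finset.range b, qFact (n + i) ∧
    ((∃ i : Fin b, n + (i:ℕ) < σ i) → M = 0) ∧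
    ((∀ i : Fin b, (σ i : ℕ) ≤ n + i) → qFact (b * n) = M * ∏ i : Fin b, qFact (n + i - σ i)) := by
  by_cases h : ∀ i : Fin b, (σ i : ℕ) ≤ n + i
  · have hsum : ∑ i : Fin b, (n + (i:ℕ) - σ i) = b * n := by
      have h1 : ∑ i : Fin b, (n + (i:ℕ) - σ i) + ∑ i : Fin b, (σ i : ℕ) = ∑ i : Fin b, (n + (i:ℕ)) := by
        rw [← Finset.sum_add_distrib]
        apply Finset.sum_congr rfl
        intro i _
        have := h i
        omega
      rw [Equiv.sum_comp σ (fun i : Fin b => (i:ℕ)), Finset.sum_add_distrib] at h1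
      simp at h1
      exact h1
    obtain ⟨M, hM⟩ := qMult_dvd (Finset.univ : Finset (Fin b)) (fun i => n + (i:ℕ) - σ i)
    rw [hsum] at hM
    refine ⟨M, ?_, ?_, ?_⟩
    · rw [hM, ← Fin.prod_univ_eq_prod_range (fun i => qFact (n+i)) b]
      have : ∏ i : Fin b, qFact (n + i) = ∏ i : Fin b, ((∏ s ∈ Finset.range (σ i : ℕ), qInt (n + i - s)) * qFact (n + i - σ i)) := by
        apply Finset.prod_congr rfl
        intro i _
        rw [qFact_desc _ _ (h i)]
      rw [this, Finset.prod_mul_distrib]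
      ring
    · rintro ⟨i, hi⟩
      have := h i
      omega
    · intro _
      rw [hM, mul_comm]
  · push Not at h
    obtain ⟨i, hi⟩ := h
    refine ⟨0, ?_, fun _ => rfl, fun h' => ?_⟩
    · rw [Finset.prod_eq_zero (i := i) (Finset.mem_univ _), mul_zero, zero_mul]
      apply Finset.prod_eq_zero (i := n + (i:ℕ)) (by rw [Finset.mem_range]; exact hi)
      rw [Nat.sub_self, qInt_zero]
    · have := h' i
      omega

/-- chosen multinomial coefficients -/
noncomputable def multM (b n : ℕ) (σ : Equiv.Perm (Fin b)) : Polynomial ℤ := (exists_mult b n σ).choose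

lemma hook_sum (b n : ℕ) : X ^ (n * ∑ j ∈ Finset.range b, j) * qFact (b*n) =
    hookD b n * ∑ σ : Equiv.Perm (Fin b), ((Equiv.Perm.sign σ : ℤ) : Polynomial ℤ) * multM b n σ := by
  have hP : (∏ i ∈ Finset.range b, qFact (n + i)) ≠ 0 := Finset.prod_ne_zero_iff.2 (fun i _ => qFact_ne _)
  have h1 : qFact (b*n) * (Qm b n).det =
      (∑ σ : Equiv.Perm (Fin b), ((Equiv.Perm.sign σ : ℤ) : Polynomial ℤ) * multM b n σ) * ∏ i ∈ Finset.range b, qFact (n + i) := by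
    rw [← Matrix.det_transpose, Matrix.det_apply', Finset.mul_sum, Finset.sum_mul]
    apply Finset.sum_congr rfl
    intro σ _
    have hs : _ = multM b n σ * _ := (exists_mult b n σ).choose_spec.1
    rw [mul_assoc, ← hs]
    simp only [Matrix.transpose_apply, Qm, Matrix.of_apply]
    ring
  apply mul_right_cancel₀ hP
  rw [mul_assoc (hookD b n), ← h1, mul_right_comm, ← Qm_det_hook]
  ring

lemma hook_dvd (b n : ℕ) : hookD b n ∣ qFact (b*n) := by
  have h : hookD b n ∣ X ^ (n * ∑ j ∈ Finset.range b, j) * qFact (b*n) := ⟨_, hook_sum b n⟩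
  have hc : IsCoprime (hookD b n) X := by
    have hd : X ∣ hookD b n - C ((hookD b n).eval 0) := by
      rw [Polynomial.X_dvd_iff]; simp [Polynomial.coeff_zero_eq_eval_zero]
    rw [hookD_eval] at hd
    obtain ⟨u, hu⟩ := hd
    refine ⟨1, -u, ?_⟩
    simp only [map_one] at hu
    linear_combination hu
  exact (hc.pow_right).dvd_of_dvd_mul_left h

lemma qHook_mul (b n : ℕ) : hookD b n * qHookRect b n = qFact (b*n) := by
  have h := Polynomial.modByMonic_add_div (qFact (b*n)) (hookD b n)
  rw [(Polynomial.modByMonic_eq_zero_iff_dvd (hookD_monic b n)).2 (hook_dvd b n), zero_add] at h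
  exact h

lemma qHook_sum (b n : ℕ) : X ^ (n * ∑ j ∈ Finset.range b, j) * qHookRect b n =
    ∑ σ : Equiv.Perm (Fin b), ((Equiv.Perm.sign σ : ℤ) : Polynomial ℤ) * multM b n σ := by
  apply mul_left_cancel₀ (hookD_monic b n).ne_zero
  rw [← hook_sum, ← qHook_mul]; ring


open Polynomial

/-! ### Evaluation at roots of unity -/

/-- the part of `[j]` prime to `[k]` -/
noncomputable def vq (k j : ℕ) : Polynomial ℤ := if k ∣ j then (qInt (j / k)).comp (X ^ k) else qInt j

/-- the corresponding part of the factorial -/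
noncomputable def uq (k m : ℕ) : Polynomial ℤ := ∏ j ∈ Finset.range m, vq k (j+1)

lemma qInt_mul (k t : ℕ) : qInt (k * t) = qInt k * (qInt t).comp (X ^ k) := by
  induction t with
  | zero => simp [qInt_zero]
  | succ t ih =>
    rw [mul_add, mul_one, qInt_add, ih, qInt_succ, Polynomial.add_comp, mul_add]
    simp only [Polynomial.pow_comp, Polynomial.X_comp, pow_mul]
    ring

lemma qFact_split (k m : ℕ) : qFact m = qInt k ^ (m / k) * uq k m := by
  induction m with
  | zero => simp [uq, qFact_zero]
  | succ m ih =>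
    have hu : uq k (m+1) = uq k m * vq k (m+1) := by unfold uq; rw [Finset.prod_range_succ]
    rw [qFact_succ, ih, hu, Nat.succ_div]
    unfold vq
    split_ifs with h
    · obtain ⟨t, ht⟩ := h
      rcases Nat.eq_zero_or_pos k with rfl | hk
      · omega
      · rw [ht, Nat.mul_div_cancel_left _ hk, qInt_mul, pow_succ]; ring
    · rw [add_zero]; ring

section
variable {k : ℕ} {w : ℂ}

lemma aeval_qInt (m : ℕ) : aeval w (qInt m) = ∑ i ∈ Finset.range m, w ^ i := by
  simp [qInt]

lemma vq_dvd (hk : 0 < k) (hw : IsPrimitiveRoot w k) (j : ℕ) : aeval w (vq k (k * j)) = j := by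
  unfold vq
  rw [if_pos (dvd_mul_right k j), Nat.mul_div_cancel_left _ hk, Polynomial.aeval_comp, aeval_qInt]
  simp [hw.pow_eq_one]

lemma vq_ne (hw : IsPrimitiveRoot w k) (j : ℕ) (hj : ¬ k ∣ j) : aeval w (vq k j) ≠ 0 := by
  unfold vq
  rw [if_neg hj, aeval_qInt]
  have h1 : w ^ j ≠ 1 := fun h => hj ((hw.pow_eq_one_iff_dvd j).1 h)
  have h2 := mul_geom_sum w j
  intro h
  rw [h, mul_zero] at h2
  exact h1 (by linear_combination -h2)

lemma vq_period (hk : 0 < k) (hw : IsPrimitiveRoot w k) (t j : ℕ) (hj : ¬ k ∣ j) :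
    aeval w (vq k (k * t + j)) = aeval w (vq k j) := by
  unfold vq
  rw [if_neg hj, if_neg (by rwa [Nat.dvd_add_right (dvd_mul_right k t)])]
  have h1 : w ≠ 1 := by
    rintro rfl
    have := (hw.pow_eq_one_iff_dvd 1).1 (by simp)
    exact hj ((Nat.dvd_one.1 this) ▸ one_dvd _)
  have h2 := mul_geom_sum w j
  have h3 := mul_geom_sum w (k * t + j)
  rw [pow_add, pow_mul, hw.pow_eq_one, one_pow, one_mul, ← h2] at h3
  rw [aeval_qInt, aeval_qInt]
  exact mul_left_cancel₀ (sub_ne_zero.2 h1) h3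

lemma uq_ne (hk : 0 < k) (hw : IsPrimitiveRoot w k) (m : ℕ) : aeval w (uq k m) ≠ 0 := by
  unfold uq
  rw [map_prod, Finset.prod_ne_zero_iff]
  intro j _
  by_cases h : k ∣ j + 1
  · obtain ⟨t, ht⟩ := h
    rw [ht, vq_dvd hk hw]
    have : t ≠ 0 := by rintro rfl; omega
    exact_mod_cast this
  · exact vq_ne hw _ h

/-- the constant -/
noncomputable def Ak (k : ℕ) (w : ℂ) : ℂ := ∏ j ∈ Finset.range (k-1), aeval w (vq k (j+1))

lemma uq_eval (hk : 0 < k) (hw : IsPrimitiveRoot w k) (t : ℕ) :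
    aeval w (uq k (k * t)) = t.factorial * Ak k w ^ t := by
  induction t with
  | zero => simp [uq]
  | succ t ih =>
    unfold uq at ih ⊢
    rw [mul_add, mul_one, Finset.prod_range_add, map_mul, ih]
    obtain ⟨k', rfl⟩ : ∃ k', k = k' + 1 := ⟨k - 1, by omega⟩
    rw [Finset.prod_range_succ, map_mul, map_prod]
    have h1 : aeval w (vq (k'+1) ((k'+1) * t + k' + 1)) = ((t + 1 : ℕ) : ℂ) := by
      rw [← vq_dvd hk hw]; congr 2
    have h2 : ∏ x ∈ Finset.range k', aeval w (vq (k'+1) ((k'+1) * t + x + 1)) = Ak (k'+1) w := by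
      unfold Ak
      apply Finset.prod_congr (by simp)
      intro x hx
      rw [Finset.mem_range] at hx
      rw [add_assoc, vq_period hk hw]
      intro h
      have := Nat.le_of_dvd (by omega) h
      omega
    rw [h1, h2, Nat.factorial_succ, pow_succ]
    push_cast; ring

lemma mult_eval {b : ℕ} (hk : 0 < k) (hw : IsPrimitiveRoot w k) (d : ℕ) (c : Fin b → ℕ) (hc : ∑ i, c i = k * d)
    (M : Polynomial ℤ) (hM : qFact (k * d) = M * ∏ i, qFact (c i)) :
    aeval w M = d.factorial * ∏ i, ((phi k (c i) : ℝ) : ℂ) := by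
  have hA : Ak k w ≠ 0 := by
    have := uq_ne hk hw (k * 1)
    rw [uq_eval hk hw] at this
    intro h
    rw [h] at this
    simp at this
  have hPhi : qInt k ≠ 0 := (qInt_monic k hk).ne_zero
  simp only [qFact_split k] at hM
  rw [Finset.prod_mul_distrib, Finset.prod_pow_eq_pow_sum, Nat.mul_div_cancel_left _ hk] at hM
  by_cases hdv : ∀ i, k ∣ c i
  · choose e he using hdv
    have hsum : ∑ i, c i / k = d := by
      have : k * ∑ i, c i / k = k * d := by
        rw [← hc, Finset.mul_sum]
        apply Finset.sum_congr rfl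
        intro i _
        rw [he i, Nat.mul_div_cancel_left _ hk]
      exact Nat.eq_of_mul_eq_mul_left hk this
    have hsum2 : ∑ i, e i = d := by
      rw [← hsum]
      apply Finset.sum_congr rfl
      intro i _
      rw [he i, Nat.mul_div_cancel_left _ hk]
    rw [hsum, mul_left_comm] at hM
    have hM2 := congrArg (aeval w) (mul_left_cancel₀ (pow_ne_zero _ hPhi) hM)
    rw [map_mul, map_prod, uq_eval hk hw] at hM2
    have h3 : ∏ i, aeval w (uq k (c i)) = (∏ i, ((e i).factorial : ℂ)) * Ak k w ^ d := by
      rw [← hsum2, ← Finset.prod_pow_eq_pow_sum, ← Finset.prod_mul_distrib]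
      apply Finset.prod_congr rfl
      intro i _
      rw [he i, uq_eval hk hw]
    have h4 : ∏ i, ((phi k (c i) : ℝ) : ℂ) = (∏ i, ((e i).factorial : ℂ))⁻¹ := by
      rw [← Finset.prod_inv_distrib]
      apply Finset.prod_congr rfl
      intro i _
      have hk' : (k:ℤ) ≠ 0 := by exact_mod_cast hk.ne'
      rw [he i, phi, if_pos ⟨by push_cast; exact dvd_mul_right _ _, by positivity⟩]
      push_cast
      rw [Int.mul_ediv_cancel_left _ hk']
      simp
    rw [h3, ← mul_assoc] at hM2
    have h5 := mul_right_cancel₀ (pow_ne_zero d hA) hM2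
    have h6 : (∏ i, ((e i).factorial : ℂ)) ≠ 0 :=
      Finset.prod_ne_zero_iff.2 (fun i _ => by exact_mod_cast (e i).factorial_ne_zero)
    rw [h4, h5, mul_inv_cancel_right₀ h6]
  · push Not at hdv
    obtain ⟨i0, hi0⟩ := hdv
    have hlt : ∑ i, c i / k < d := by
      have : k * ∑ i, c i / k < k * d := by
        rw [← hc, Finset.mul_sum]
        apply Finset.sum_lt_sum (fun i _ => Nat.mul_div_le _ _)
        refine ⟨i0, Finset.mem_univ _, lt_of_le_of_ne (Nat.mul_div_le _ _) ?_⟩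
        intro h
        exact hi0 ⟨_, h.symm⟩
      exact Nat.lt_of_mul_lt_mul_left this
    obtain ⟨t, ht⟩ : ∃ t, d = ∑ i, c i / k + (t + 1) := ⟨d - ∑ i, c i / k - 1, by omega⟩
    have hk1 : aeval w (qInt k) = 0 := by
      rw [aeval_qInt]
      apply hw.geom_sum_eq_zero
      by_contra h
      have : k = 1 := by omega
      subst this
      exact hi0 (one_dvd _)
    have hM1 : qInt k ^ (t+1) * uq k (k * d) = M * ∏ i, uq k (c i) := by
      apply mul_left_cancel₀ (pow_ne_zero (∑ i, c i / k) hPhi)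
      rw [← mul_assoc, ← pow_add, ← ht, hM]; ring
    have hM2 := congrArg (aeval w) hM1
    rw [map_mul, map_pow, hk1, zero_pow (by omega), zero_mul, map_mul, map_prod] at hM2
    have h3 : ∏ i, aeval w (uq k (c i)) ≠ 0 := Finset.prod_ne_zero_iff.2 (fun i _ => uq_ne hk hw _)
    have h4 : aeval w M = 0 := by
      rcases mul_eq_zero.1 hM2.symm with h | h
      · exact h
      · exact absurd h h3
    rw [h4, Finset.prod_eq_zero (Finset.mem_univ i0), mul_zero]
    rw [phi, if_neg]
    · simp
    · rintro ⟨h, _⟩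
      exact hi0 (by exact_mod_cast h)

lemma multM_eval (b n : ℕ) (hk : 0 < k) (hw : IsPrimitiveRoot w k) (d : ℕ) (hd : k * d = b * n)
    (σ : Equiv.Perm (Fin b)) :
    aeval w (multM b n σ) = d.factorial * ∏ i : Fin b, ((phi k ((n:ℤ) - (σ i : Fin b) + i) : ℝ) : ℂ) := by
  have hs : _ ∧ (_ → multM b n σ = 0) ∧ (_ → _ = multM b n σ * _) := (exists_mult b n σ).choose_spec
  by_cases h : ∀ i : Fin b, (σ i : ℕ) ≤ n + i
  · have hsum : ∑ i : Fin b, (n + (i:ℕ) - σ i) = k * d := by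
      have h1 : ∑ i : Fin b, (n + (i:ℕ) - σ i) + ∑ i : Fin b, (σ i : ℕ) = ∑ i : Fin b, (n + (i:ℕ)) := by
        rw [← Finset.sum_add_distrib]
        apply Finset.sum_congr rfl
        intro i _
        have := h i
        omega
      rw [Equiv.sum_comp σ (fun i : Fin b => (i:ℕ)), Finset.sum_add_distrib] at h1
      simp at h1
      rw [h1, hd]
    have h2 := hs.2.2 h
    rw [← hd] at h2
    rw [mult_eval hk hw d _ hsum _ h2]
    congr 1
    apply Finset.prod_congr rfl
    intro i _
    congr 2
    have := h i
    omega
  · push Not at h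
    obtain ⟨i, hi⟩ := h
    rw [hs.2.1 ⟨i, hi⟩, map_zero, Finset.prod_eq_zero (Finset.mem_univ i), mul_zero]
    rw [phi, if_neg]
    · simp
    · omega

lemma qHook_eval (b n : ℕ) (hk : 0 < k) (hw : IsPrimitiveRoot w k) (d : ℕ) (hd : k * d = b * n) :
    w ^ (n * ∑ j ∈ Finset.range b, j) * aeval w (qHookRect b n) =
      (((d.factorial : ℝ) * (Matrix.of fun i j : Fin b => phi k ((n:ℤ) - i + j)).det : ℝ) : ℂ) := by
  have h := congrArg (aeval w) (qHook_sum b n)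
  rw [map_mul, map_pow, aeval_X] at h
  rw [h, map_sum, Matrix.det_apply', Finset.mul_sum, Complex.ofReal_sum]
  apply Finset.sum_congr rfl
  intro σ _
  rw [map_mul, multM_eval b n hk hw d hd]
  simp only [Matrix.of_apply]
  push_cast
  simp
  ring

lemma root_sign (b n : ℕ) (hk : 0 < k) (hw : IsPrimitiveRoot w k) (d : ℕ) (hd : k * d = b * n) :
    w ^ (n * ∑ j ∈ Finset.range b, j) = ((-1) ^ (b-1)) ^ d := by
  have h2 : (n * ∑ j ∈ Finset.range b, j) * 2 = k * d * (b - 1) := by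
    rw [mul_assoc, Finset.sum_range_id_mul_two, hd]; ring
  rcases Nat.even_or_odd (b-1) with ⟨c, hc⟩ | ⟨c, hc⟩
  · have : n * ∑ j ∈ Finset.range b, j = k * (d * c) := by
      rw [hc] at h2
      nlinarith
    rw [this, pow_mul, hw.pow_eq_one, one_pow, hc, ← two_mul, pow_mul]
    simp
  · rcases Nat.even_or_odd d with ⟨d', hd'⟩ | ⟨d', hd'⟩
    · have : n * ∑ j ∈ Finset.range b, j = k * (d' * (b-1)) := by
        rw [hd'] at h2
        nlinarith
      rw [this, pow_mul, hw.pow_eq_one, one_pow, hd', ← pow_mul, mul_comm, ← two_mul, mul_assoc, pow_mul]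
      simp
    · have hke : Even k := by
        by_contra hko
        rw [Nat.not_even_iff_odd] at hko
        have hodd : Odd (k * d) := hko.mul ⟨d', hd'⟩
        have heven : Even (b * n) := Even.mul_right ⟨c + 1, by omega⟩ n
        rw [hd] at hodd
        exact (Nat.not_odd_iff_even.2 heven) hodd
      obtain ⟨k', hk'⟩ := hke
      have hm : w ^ k' = -1 := by
        have h1 : (w ^ k') ^ 2 = 1 := by
          rw [← pow_mul, mul_two, ← hk', hw.pow_eq_one]
        rcases mul_self_eq_one_iff.1 ((sq (w ^ k')).symm.trans h1) with h | h
        · exfalso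
          have := Nat.le_of_dvd (by omega) ((hw.pow_eq_one_iff_dvd k').1 h)
          omega
        · exact h
      have : n * ∑ j ∈ Finset.range b, j = k' * ((b-1) * d) := by
        rw [hk'] at h2
        nlinarith
      rw [this, pow_mul, hm, pow_mul]

end


open Polynomial

/-! ### Conclusion -/

lemma fix_gcd (b n : ℕ) (hN : 0 < b * n) (d : ℕ) :
    {f | IsStdFilling (RC b n) (b * n) f ∧ (promote (b * n))^[d] f = f} =
    {f | IsStdFilling (RC b n) (b * n) f ∧ (promote (b * n))^[d.gcd (b*n)] f = f} := by
  ext f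
  rw [Set.mem_ofPred_eq, Set.mem_ofPred_eq]
  constructor
  · rintro ⟨hf, h⟩
    refine ⟨hf, ?_⟩
    have h1 : Function.IsPeriodicPt (promote (b*n)) d f := h
    have h2 : Function.IsPeriodicPt (promote (b*n)) (b*n) f := promote_order hN f hf
    exact h1.gcd h2
  · rintro ⟨hf, h⟩
    refine ⟨hf, ?_⟩
    have h1 : Function.IsPeriodicPt (promote (b*n)) (d.gcd (b*n)) f := h
    exact h1.trans_dvd (Nat.gcd_dvd_left _ _)

lemma csp_dvd (b n : ℕ) (hN : 0 < b * n) (k d : ℕ) (hk : 0 < k) (hd : 0 < d) (hkd : k * d = b * n) (w : ℂ)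
    (hw : IsPrimitiveRoot w k) :
    (({f | IsStdFilling (RC b n) (b * n) f ∧ (promote (b * n))^[d] f = f}).ncard : ℂ) = aeval w (qHookRect b n) := by
  classical
  haveI := (SFl.fin (N := b*n) (RC_finite b n)).fintype
  have h1 := fix_trace (b := b) (n := n) hN d
  rw [trace_conj (SFl.good (RC_ideal b n)) k d hk hd hkd, trace_block k hN, block_det n k d hk hN hkd] at h1
  have h2 := qHook_eval b n hk hw d hkd
  rw [← h1, root_sign b n hk hw d hkd] at h2
  push_cast at h2
  have h3 : (((-1:ℂ)) ^ (b-1)) ^ d ≠ 0 := pow_ne_zero _ (pow_ne_zero _ (by norm_num))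
  exact (mul_left_cancel₀ h3 h2).symm

lemma csp_zero (b n : ℕ) (hN : b * n = 0) (d : ℕ) (w : ℂ) :
    (({f | IsStdFilling (RC b n) (b * n) f ∧ (promote (b * n))^[d] f = f}).ncard : ℂ) = aeval w (qHookRect b n) := by
  have hno : ∀ c, ¬ RC b n c := by
    intro c hc
    rw [RC_iff] at hc
    have : 0 < b * n := Nat.mul_pos (by omega) (by omega)
    omega
  have hp : ∀ d, (promote (b*n))^[d] 0 = 0 := by
    intro d
    have h1 : promote (b*n) 0 = 0 := by
      rw [hN]
      funext c
      simp [promote, jdtSlide]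
    exact Function.iterate_fixed h1 d
  have hs : {f | IsStdFilling (RC b n) (b * n) f ∧ (promote (b * n))^[d] f = f} = {0} := by
    ext f
    rw [Set.mem_ofPred_eq, Set.mem_singleton_iff]
    constructor
    · rintro ⟨hf, _⟩
      funext c
      exact hf.1 c (hno c)
    · rintro rfl
      exact ⟨⟨fun _ _ => rfl, fun c hc => absurd hc (hno c), fun c _ hc => absurd hc (hno c),
        fun v h1 h2 => by omega, fun a b h => absurd h (hno _), fun a b h => absurd h (hno _)⟩, hp d⟩
  have hD : hookD b n = 1 := by
    unfold hookD
    rcases Nat.mul_eq_zero.1 hN with h | h <;> subst h <;> simp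
  have hq := qHook_mul b n
  rw [hD, one_mul, hN, qFact_zero] at hq
  rw [hs, hq]
  simp

/-- (Rhoades, Theorem 3.9.)  Let `λ ⊢ N` be a rectangular shape, let `X = SYT(λ)`, and let
`C = ℤ/Nℤ` act on `X` by jeu de taquin promotion.  Then `(X, C, X(q))` exhibits the cyclic
sieving phenomenon, where `X(q)` is the `q`-analogue of the hook length formula: for every
`d ≥ 0`, the number of standard Young tableaux of shape `λ` fixed by `p^d` equals `X(ζ^d)`,
`ζ` being a primitive `N`-th root of unity. -/
theorem rectangular_tableaux_promotion_cyclic_sieving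
    (b n : ℕ) (ζ : ℂ) (hζ : IsPrimitiveRoot ζ (b * n)) (d : ℕ) :
    (({f | IsStdFilling (strCell (rectShape b n)) (b * n) f ∧
        (promote (b * n))^[d] f = f}).ncard : ℂ) =
      Polynomial.aeval (ζ ^ d) (qHookRect b n) := by
  rcases Nat.eq_zero_or_pos (b * n) with hN | hN
  · exact csp_zero b n hN d _
  · have hg := fix_gcd b n hN d
    unfold RC at hg
    rw [hg]
    have hgpos : 0 < d.gcd (b*n) := Nat.gcd_pos_of_pos_right _ hN
    have hdv : d.gcd (b*n) ∣ b*n := Nat.gcd_dvd_right _ _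
    have hw : IsPrimitiveRoot (ζ ^ d) (b*n / d.gcd (b*n)) := by
      have h := IsPrimitiveRoot.orderOf (ζ ^ d)
      have hne : IsOfFinOrder ζ := isOfFinOrder_iff_pow_eq_one.2 ⟨b*n, hN, hζ.pow_eq_one⟩
      rw [hne.orderOf_pow, ← hζ.eq_orderOf, Nat.gcd_comm] at h
      exact h
    exact csp_dvd b n hN _ _ (Nat.div_pos (Nat.le_of_dvd hN hdv) hgpos) hgpos (Nat.div_mul_cancel hdv) _ hw
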